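/- arXiv:1910.04452 — 4 statements merged into one kernel-verified Lean document; each statement's English description precedes it below -/
import Mathlib

section
/- There exists a continuous linear operator T on the complex Banach space ℓ¹(ℕ) such that T is bijective with continuous inverse, T is frequently hypercyclic, and T⁻¹ is not frequently hypercyclic. -/
open scoped Classical

noncomputable section

/-- `X = ℓ¹(ℕ)`, the complex Banach space of absolutely summable complex sequences. -/
abbrev X : Type := lp (fun _ : ℕ => ℂ) 1

/-- An operator `T` on `X` is frequently hypercyclic if there is `x ∈ X` such that for every
non-empty open set `U ⊆ X` the set `{n : T^n x ∈ U}` has positive lower density. -/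
def FrequentlyHypercyclic (T : X →L[ℂ] X) : Prop :=
  ∃ x : X, ∀ U : Set X, IsOpen U → U.Nonempty →
    0 < Filter.liminf (fun N : ℕ =>
      (((Finset.range N).filter (fun n => (T ^ n) x ∈ U)).card : ℝ) / N) Filter.atTop

namespace InverseFHC

/-! ### Generalities on `ℓ¹(ℕ)` -/

/-- The canonical basis of `ℓ¹(ℕ)`. -/
def b (n : ℕ) : X := lp.single 1 n 1

theorem norm_b (n : ℕ) : ‖b n‖ = 1 := by
  simp [b, lp.norm_single (E := fun _ : ℕ => ℂ) (p := 1) one_pos]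

theorem b_apply (n m : ℕ) : b n m = if m = n then 1 else 0 := by
  by_cases h : m = n
  · subst h; simp [b]
  · simp [b, h]

theorem hasSum_norm (x : X) : HasSum (fun n => ‖x n‖) ‖x‖ := by
  simpa using lp.hasSum_norm (p := 1) (by simp) x

theorem norm_apply_le (x : X) (n : ℕ) : ‖x n‖ ≤ ‖x‖ :=
  lp.norm_apply_le_norm one_ne_zero x n

theorem sum_norm_apply_le (x : X) (s : Finset ℕ) : ∑ n ∈ s, ‖x n‖ ≤ ‖x‖ :=
  sum_le_hasSum s (fun _ _ => norm_nonneg _) (hasSum_norm x)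

theorem hasSum_basis (x : X) : HasSum (fun n => x n • b n) x := by
  have h := lp.hasSum_single (p := 1) ENNReal.one_ne_top x
  simpa [b, ← lp.single_smul] using h

section

variable {F : Type*} [NormedAddCommGroup F] [NormedSpace ℂ F]

theorem hasSum_map (L : X →L[ℂ] F) (x : X) : HasSum (fun n => x n • L (b n)) (L x) := by
  simpa using L.hasSum (hasSum_basis x)

theorem norm_map_le (L : X →L[ℂ] F) (z : X) (δ : ℝ)
    (h : ∀ n, z n ≠ 0 → ‖L (b n)‖ ≤ δ) : ‖L z‖ ≤ δ * ‖z‖ := by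
  have h1 := (hasSum_norm z).mul_left δ
  refine (hasSum_map L z).norm_le_of_bounded h1 fun n => ?_
  rw [norm_smul]
  by_cases hz : z n = 0
  · simp [hz]
  · rw [mul_comm]
    exact mul_le_mul_of_nonneg_right (h n hz) (norm_nonneg _)

theorem map_eq_of_single (ψ : X →L[ℂ] ℂ) (z : X) (m : ℕ)
    (h : ∀ n, n ≠ m → z n ≠ 0 → ψ (b n) = 0) : ψ z = z m * ψ (b m) := by
  refine (hasSum_map ψ z).unique (hasSum_single m fun n hn => ?_)
  by_cases hz : z n = 0
  · simp [hz]
  · simp [h n hn hz]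

theorem ext_basis {L L' : X →L[ℂ] F} (h : ∀ n, L (b n) = L' (b n)) : L = L' := by
  ext1 x
  refine (hasSum_map L x).unique ?_
  simp only [h]
  exact hasSum_map L' x

end

theorem summable_smul {f : ℕ → X} {M : ℝ} (h : ∀ n, ‖f n‖ ≤ M) (x : X) :
    Summable fun n => x n • f n := by
  refine Summable.of_norm_bounded ((hasSum_norm x).summable.mul_right M) fun n => ?_
  rw [norm_smul]
  exact mul_le_mul_of_nonneg_left (h n) (norm_nonneg _)

/-- The operator sending the `n`-th basis vector to `f n`. -/
def opOf (f : ℕ → X) (M : ℝ) (h : ∀ n, ‖f n‖ ≤ M) : X →L[ℂ] X :=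
  LinearMap.mkContinuous
    { toFun := fun x => ∑' n, x n • f n
      map_add' := fun x y => by
        rw [← (summable_smul h x).tsum_add (summable_smul h y)]
        simp [add_smul]
      map_smul' := fun c x => by
        simp only [RingHom.id_apply]
        rw [← (summable_smul h x).tsum_const_smul c]
        simp [mul_smul] } M fun x => by
    have h1 := (hasSum_norm x).mul_left M
    refine (summable_smul h x).hasSum.norm_le_of_bounded h1 fun n => ?_
    rw [norm_smul, mul_comm]
    exact mul_le_mul_of_nonneg_right (h n) (norm_nonneg _)

theorem opOf_b (f : ℕ → X) (M : ℝ) (h : ∀ n, ‖f n‖ ≤ M) (m : ℕ) : opOf f M h (b m) = f m := by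
  change ∑' n, b m n • f n = f m
  rw [tsum_eq_single m]
  · simp [b_apply]
  · intro n hn
    simp [b_apply, hn]

theorem norm_opOf_le (f : ℕ → X) (M : ℝ) (h : ∀ n, ‖f n‖ ≤ M) : ‖opOf f M h‖ ≤ M :=
  LinearMap.mkContinuous_norm_le _ ((norm_nonneg _).trans (h 0)) _

/-- The `n`-th coordinate functional. -/
def ev (n : ℕ) : X →L[ℂ] ℂ := lp.evalCLM ℂ (fun _ : ℕ => ℂ) 1 n

@[simp]
theorem ev_apply (n : ℕ) (x : X) : ev n x = x n := rfl

/-- The projection onto the coordinates in `s`. -/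
def proj (s : Set ℕ) : X →L[ℂ] X :=
  opOf (fun n => if n ∈ s then b n else 0) 1 fun n => by
    split_ifs <;> simp [norm_b]

theorem proj_b (s : Set ℕ) (n : ℕ) : proj s (b n) = if n ∈ s then b n else 0 := opOf_b _ _ _ _

theorem proj_apply (s : Set ℕ) (x : X) (n : ℕ) : proj s x n = if n ∈ s then x n else 0 := by
  have h := map_eq_of_single ((ev n).comp (proj s)) x n (fun m hm _ => by
    simp only [ContinuousLinearMap.comp_apply, proj_b, ev_apply]
    split_ifs <;> simp [b_apply, hm.symm])
  simp only [ContinuousLinearMap.comp_apply, proj_b, ev_apply] at h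
  rw [h]
  split_ifs <;> simp [b_apply]

theorem norm_proj_apply_le (s : Set ℕ) (x : X) : ‖proj s x‖ ≤ ‖x‖ := by
  have := (proj s).le_of_opNorm_le (norm_opOf_le _ _ _) x
  simpa using this

/-! ### Blocks, positions and weights -/

/-- The delay attached to the block of level `k`. -/
def N (k : ℕ) : ℕ := 2 ^ (k + 4)

/-- The length of the block of level `k`. -/
def C (k : ℕ) : ℕ := 2 ^ (2 * k + 10)

/-- The depth of position `p` in the block of level `k`. -/
def depth (k p : ℕ) : ℕ :=
  max (min (p - (C k - 2 * N k)) (C k - p)) (min (p - N k / 2) (N k - p))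

/-- The weight of position `p` in the block of level `k`. -/
def u (k p : ℕ) : ℝ := (1 / 2) ^ depth k p

theorem N_pos (k : ℕ) : 0 < N k := by unfold N; positivity

theorem C_pos (k : ℕ) : 0 < C k := by unfold C; positivity

theorem N_succ (k : ℕ) : N (k + 1) = 2 * N k := by unfold N; ring

theorem C_eq (k : ℕ) : C k = 2 ^ (k + 6) * N k := by
  rw [C, N, ← pow_add]; congr 1; ring

theorem sixty_four_mul_N_le (k : ℕ) : 64 * N k ≤ C k := by
  rw [C_eq]
  exact Nat.mul_le_mul_right _ (by
    calc 64 = 2 ^ 6 := by norm_num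
      _ ≤ 2 ^ (k + 6) := Nat.pow_le_pow_right (by norm_num) (by omega))

theorem C_succ (k : ℕ) : C (k + 1) = 4 * C k := by unfold C; ring

theorem C_mono {j k : ℕ} (h : j ≤ k) : C j ≤ C k :=
  Nat.pow_le_pow_right (by norm_num) (by omega)

theorem N_mono {j k : ℕ} (h : j ≤ k) : N j ≤ N k :=
  Nat.pow_le_pow_right (by norm_num) (by omega)

theorem four_mul_C_le {j k : ℕ} (h : j < k) : 4 * C j ≤ C k := by
  rw [← C_succ]; exact C_mono h

theorem two_mul_C_dvd_C {j k : ℕ} (h : j < k) : 2 * C j ∣ C k := by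
  rw [C, C, ← pow_succ']; exact pow_dvd_pow _ (by omega)

theorem two_mul_C_dvd_N {j k : ℕ} (h : 2 * j + 7 ≤ k) : 2 * C j ∣ N k := by
  rw [C, N, ← pow_succ']; exact pow_dvd_pow _ (by omega)

theorem u_pos (k p : ℕ) : 0 < u k p := by unfold u; positivity

theorem u_le_one (k p : ℕ) : u k p ≤ 1 := pow_le_one₀ (by norm_num) (by norm_num)

theorem u_le_two_mul {k p q : ℕ} (h : depth k p ≤ depth k q + 1) : u k q ≤ 2 * u k p := by
  unfold u
  have : (1 / 2 : ℝ) ^ (depth k q + 1) ≤ (1 / 2) ^ depth k p :=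
    pow_le_pow_of_le_one (by norm_num) (by norm_num) h
  rw [pow_succ] at this
  linarith

theorem depth_zero (k : ℕ) : depth k 0 = 0 := by
  have := sixty_four_mul_N_le k; have := N_pos k
  unfold depth; omega

theorem depth_last (k : ℕ) : depth k (C k - 1) = 1 := by
  have := sixty_four_mul_N_le k; have := N_pos k
  unfold depth; omega

theorem u_last (k : ℕ) : u k (C k - 1) = 1 / 2 := by simp [u, depth_last]

theorem depth_le_succ (k p : ℕ) : depth k p ≤ depth k (p + 1) + 1 := by
  unfold depth
  rw [← max_add_add_right, ← min_add_add_right, ← min_add_add_right]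
  exact max_le_max (min_le_min (by omega) (by omega)) (min_le_min (by omega) (by omega))

theorem depth_succ_le (k p : ℕ) : depth k (p + 1) ≤ depth k p + 1 := by
  unfold depth
  rw [← max_add_add_right, ← min_add_add_right, ← min_add_add_right]
  exact max_le_max (min_le_min (by omega) (by omega)) (min_le_min (by omega) (by omega))

/-- The positions of the block of level `k` are enumerated by `ℕ`, jointly in `k`. -/
def blockEquiv : ℕ ≃ Σ k, Fin (C k) :=
  haveI : Infinite (Σ k, Fin (C k)) :=
    Infinite.of_injective (fun k => (⟨k, ⟨0, C_pos k⟩⟩ : Σ k, Fin (C k))) fun _ _ h =>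
      congrArg Sigma.fst h
  haveI := Denumerable.ofEncodableOfInfinite (Σ k, Fin (C k))
  (Denumerable.eqv (Σ k, Fin (C k))).symm

attribute [irreducible] blockEquiv

/-- The level of the block containing the index `n`. -/
def level (n : ℕ) : ℕ := (blockEquiv n).1

/-- The position of the index `n` inside its block. -/
def pos (n : ℕ) : ℕ := (blockEquiv n).2

/-- The index of position `p` in the block of level `k`. -/
def idx (k p : ℕ) : ℕ := if h : p < C k then blockEquiv.symm ⟨k, ⟨p, h⟩⟩ else 0

theorem pos_lt (n : ℕ) : pos n < C (level n) := (blockEquiv n).2.2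

@[simp]
theorem idx_level_pos (n : ℕ) : idx (level n) (pos n) = n := by
  have eta : ∀ s : Σ k, Fin (C k), (⟨s.1, ⟨s.2, s.2.2⟩⟩ : Σ k, Fin (C k)) = s := fun _ => rfl
  rw [idx, dif_pos (pos_lt n)]
  exact blockEquiv.symm_apply_eq.2 (eta (blockEquiv n))

theorem level_idx {k p : ℕ} (h : p < C k) : level (idx k p) = k := by
  simp [level, idx, h]

theorem pos_idx {k p : ℕ} (h : p < C k) : pos (idx k p) = p := by
  unfold pos
  rw [idx, dif_pos h, Equiv.apply_symm_apply]

theorem idx_inj {k p k' p' : ℕ} (h : p < C k) (h' : p' < C k') :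
    idx k p = idx k' p' ↔ k = k' ∧ p = p' := by
  constructor
  · intro heq
    exact ⟨by rw [← level_idx h, heq, level_idx h'], by rw [← pos_idx h, heq, pos_idx h']⟩
  · rintro ⟨rfl, rfl⟩; rfl

/-- The weighted basis vector at position `p` of the block of level `k`. -/
def e (k p : ℕ) : X := (u k p : ℂ) • b (idx k p)

theorem norm_e (k p : ℕ) : ‖e k p‖ = u k p := by
  rw [e, norm_smul, norm_b, mul_one, Complex.norm_real, Real.norm_of_nonneg (u_pos k p).le]

theorem norm_e_le_one (k p : ℕ) : ‖e k p‖ ≤ 1 := (norm_e k p).trans_le (u_le_one k p)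

theorem u_ne_zero (k p : ℕ) : (u k p : ℂ) ≠ 0 := by
  exact_mod_cast (u_pos k p).ne'

theorem b_eq (n : ℕ) : b n = (u (level n) (pos n) : ℂ)⁻¹ • e (level n) (pos n) := by
  rw [e, smul_smul, inv_mul_cancel₀ (u_ne_zero _ _), one_smul, idx_level_pos]

theorem e_apply {k p k' p' : ℕ} (h : p < C k) (h' : p' < C k') :
    e k p (idx k' p') = if k' = k ∧ p' = p then (u k p : ℂ) else 0 := by
  change (u k p : ℂ) * b (idx k p) (idx k' p') = _
  simp only [b_apply, idx_inj h' h, mul_ite, mul_one, mul_zero]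

theorem norm_inv_u_smul (k p : ℕ) (w : X) :
    ‖((u k p : ℂ)⁻¹ • w)‖ = (u k p)⁻¹ * ‖w‖ := by
  rw [norm_smul, norm_inv, Complex.norm_real, Real.norm_of_nonneg (u_pos k p).le]

/-! ### Vectors supported in low blocks -/

/-- `w` lies in the span of the blocks of level `< i`, with coefficients of total mass at most `μ`
with respect to the weighted basis; this is phrased dually, through seminorms. -/
def Adm (i : ℕ) (μ : ℝ) (w : X) : Prop :=
  ∀ (q : Seminorm ℂ X) (B : ℝ), 0 ≤ B → (∀ j < i, ∀ p < C j, q (e j p) ≤ B) → q w ≤ B * μ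

theorem Adm.mono {i i' : ℕ} {μ μ' : ℝ} {w : X} (h : Adm i μ w) (hi : i ≤ i') (hμ : μ ≤ μ') :
    Adm i' μ' w := fun q B hB hq =>
  (h q B hB fun j hj => hq j (by omega)).trans (mul_le_mul_of_nonneg_left hμ hB)

theorem Adm.zero (i : ℕ) : Adm i 0 (0 : X) := fun q B _ _ => by simp

theorem Adm.add {i : ℕ} {μ μ' : ℝ} {w w' : X} (h : Adm i μ w) (h' : Adm i μ' w') :
    Adm i (μ + μ') (w + w') := fun q B hB hq => by
  have := map_add_le_add q w w'
  have := h q B hB hq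
  have := h' q B hB hq
  linarith

theorem Adm.smul {i : ℕ} {μ : ℝ} {w : X} (h : Adm i μ w) (c : ℂ) : Adm i (‖c‖ * μ) (c • w) :=
  fun q B hB hq => by
  rw [map_smul_eq_mul]
  have := mul_le_mul_of_nonneg_left (h q B hB hq) (norm_nonneg c)
  linarith

theorem Adm.e {i j p : ℕ} (hj : j < i) (hp : p < C j) : Adm i 1 (e j p) := fun q B hB hq => by
  rw [mul_one]; exact hq j hj p hp

theorem Adm.norm_map_le {F : Type*} [NormedAddCommGroup F] [NormedSpace ℂ F]
    {i : ℕ} {μ : ℝ} {w : X} (h : Adm i μ w) (L : X →L[ℂ] F) {B : ℝ}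
    (hB : 0 ≤ B) (hL : ∀ j < i, ∀ p < C j, ‖L (InverseFHC.e j p)‖ ≤ B) : ‖L w‖ ≤ B * μ :=
  h ((normSeminorm ℂ F).comp (L : X →ₗ[ℂ] F)) B hB hL

theorem Adm.map_eq {F : Type*} [NormedAddCommGroup F] [NormedSpace ℂ F]
    {i : ℕ} {μ : ℝ} {w : X} (h : Adm i μ w) (L L' : X →L[ℂ] F)
    (hL : ∀ j < i, ∀ p < C j, L (InverseFHC.e j p) = L' (InverseFHC.e j p)) : L w = L' w := by
  have := h.norm_map_le (L - L') le_rfl fun j hj p hp => by simp [hL j hj p hp]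
  rw [zero_mul, norm_le_zero_iff] at this
  exact sub_eq_zero.1 this

theorem Adm.norm_le {i : ℕ} {μ : ℝ} {w : X} (h : Adm i μ w) : ‖w‖ ≤ μ := by
  simpa using h.norm_map_le (ContinuousLinearMap.id ℂ X) zero_le_one
    fun j _ p _ => norm_e_le_one j p

theorem exists_adm_b (n : ℕ) : ∃ i μ, Adm i μ (b n) := by
  rw [b_eq]
  exact ⟨_, _, (Adm.e (Nat.lt_succ_self _) (pos_lt n)).smul _⟩

/-! ### The target vectors -/

/-- A dense sequence of finitely supported vectors. -/
def v (n : ℕ) : X :=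
  ((Denumerable.ofNat (List (ℕ × ℕ)) n).map
    fun q => TopologicalSpace.denseSeq ℂ q.1 • b q.2).sum

theorem exists_adm_v (n : ℕ) : ∃ i μ, Adm i μ (v n) := by
  unfold v
  induction Denumerable.ofNat (List (ℕ × ℕ)) n with
  | nil => exact ⟨0, 0, by simpa using Adm.zero 0⟩
  | cons q l ih =>
    obtain ⟨i, μ, h⟩ := ih
    obtain ⟨i', μ', h'⟩ := exists_adm_b q.2
    rw [List.map_cons, List.sum_cons]
    exact ⟨max i i', _, ((h'.smul _).mono (le_max_right _ _) le_rfl).add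
      (h.mono (le_max_left _ _) le_rfl)⟩

theorem denseRange_v : DenseRange v := by
  let M : AddSubmonoid X :=
    { carrier := Set.range v
      zero_mem' := ⟨Encodable.encode ([] : List (ℕ × ℕ)), by simp [v]⟩
      add_mem' := by
        rintro _ _ ⟨m, rfl⟩ ⟨n, rfl⟩
        refine ⟨Encodable.encode (Denumerable.ofNat (List (ℕ × ℕ)) m ++
          Denumerable.ofNat (List (ℕ × ℕ)) n), ?_⟩
        simp [v] }
  have hb : ∀ (c : ℂ) (n : ℕ), c • b n ∈ M.topologicalClosure := by
    intro c n
    have hc := TopologicalSpace.denseRange_denseSeq ℂ c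
    have hcont : Continuous fun z : ℂ => z • b n := by fun_prop
    refine map_mem_closure (f := fun z : ℂ => z • b n) hcont hc ?_
    rintro _ ⟨m, rfl⟩
    exact ⟨Encodable.encode [((m, n) : ℕ × ℕ)], by simp [v]⟩
  intro x
  have hx : x ∈ M.topologicalClosure :=
    M.isClosed_topologicalClosure.mem_of_tendsto (hasSum_basis x)
      (Filter.Eventually.of_forall fun s => sum_mem fun n _ => hb _ _)
  exact hx

/-- The vector which the orbit visits at level `k`. -/
def y (k : ℕ) : X :=
  if 0 < k ∧ Adm ((k - 5) / 2) (2 ^ k) (v (padicValNat 2 k)) then v (padicValNat 2 k) else 0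

theorem y_zero : y 0 = 0 := by simp [y]

theorem adm_y (k : ℕ) : Adm ((k - 5) / 2) (2 ^ k) (y k) := by
  unfold y
  split_ifs with h
  · exact h.2
  · exact (Adm.zero _).mono le_rfl (by positivity)

theorem eventually_y_eq (n : ℕ) : ∃ K, ∀ k ≥ K, padicValNat 2 k = n → y k = v n := by
  obtain ⟨i, μ, h⟩ := exists_adm_v n
  obtain ⟨m, hm⟩ := pow_unbounded_of_one_lt μ one_lt_two
  refine ⟨max m (2 * i + 5) + 1, fun k hk hn => ?_⟩
  rw [y, hn, if_pos]
  refine ⟨by omega, h.mono (by omega) (hm.le.trans ?_)⟩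
  exact pow_le_pow_right₀ one_le_two (by omega)

/-- The size of the seed vector placed in the block of level `k`. -/
def lam (k : ℕ) : ℝ := 2 ^ ((k + 2) ^ 2)

theorem lam_pos (k : ℕ) : 0 < lam k := by unfold lam; positivity

/-- The vector emitted when the block of level `k` is traversed. -/
def a : ℕ → X
  | 0 => 0
  | k + 1 => (lam (k + 1) : ℂ)⁻¹ • (y (k + 1) - y k + (lam k : ℂ) • e k (N k))

theorem adm_a (k : ℕ) : Adm k ((1 / 4) ^ (k + 1)) (a k) := by
  cases k with
  | zero => exact (Adm.zero _).mono le_rfl (by positivity)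
  | succ k =>
    have hN : N k < C k := by have := sixty_four_mul_N_le k; have := N_pos k; omega
    have h1 := (adm_y (k + 1)).mono (show (k + 1 - 5) / 2 ≤ k + 1 by omega) le_rfl
    have h2 := ((adm_y k).mono (show (k - 5) / 2 ≤ k + 1 by omega) le_rfl).smul (-1)
    have h3 := (Adm.e (Nat.lt_succ_self k) hN).smul (lam k : ℂ)
    have h := ((h1.add h2).add h3).smul (lam (k + 1) : ℂ)⁻¹
    rw [neg_one_smul, ← sub_eq_add_neg] at h
    refine h.mono le_rfl ?_
    rw [norm_inv, Complex.norm_real, Complex.norm_real, Real.norm_of_nonneg (lam_pos _).le,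
      Real.norm_of_nonneg (lam_pos _).le, norm_neg, norm_one, inv_mul_le_iff₀ (lam_pos _)]
    have e1 : lam (k + 1) * (1 / 4) ^ (k + 1 + 1) = 2 * 2 ^ (k ^ 2 + 4 * k + 4) := by
      have : lam (k + 1) = 2 * 2 ^ (k ^ 2 + 4 * k + 4) * 4 ^ (k + 1 + 1) := by
        rw [lam, show (4 : ℝ) = 2 ^ 2 by norm_num, ← pow_mul, ← pow_succ', ← pow_add]
        congr 1; ring
      rw [this, mul_assoc, ← mul_pow]; norm_num
    have e2 : lam k = 2 ^ (k ^ 2 + 4 * k + 4) := by rw [lam]; congr 1; ring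
    have e3 : (2 : ℝ) ^ (k + 2) ≤ 2 ^ (k ^ 2 + 4 * k + 4) :=
      pow_le_pow_right₀ one_le_two (by nlinarith)
    have e4 : (2 : ℝ) ^ (k + 2) = 4 * 2 ^ k := by ring
    have e5 : (2 : ℝ) ^ (k + 1) = 2 * 2 ^ k := by ring
    have : (0 : ℝ) < 2 ^ k := by positivity
    rw [e1, e2]
    linarith

/-! ### The operator -/

theorem norm_inv_u_smul_e_le {k p q : ℕ} (h : depth k p ≤ depth k q + 1) :
    ‖(u k p : ℂ)⁻¹ • e k q‖ ≤ 2 := by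
  rw [norm_inv_u_smul, norm_e, inv_mul_le_iff₀ (u_pos k p), mul_comm]
  exact u_le_two_mul h

theorem apply_e_of_apply_b {L : X →L[ℂ] X} {k p : ℕ} (w : X)
    (h : L (b (idx k p)) = (u k p : ℂ)⁻¹ • w) : L (e k p) = w := by
  rw [e, map_smul, h, smul_smul, mul_inv_cancel₀ (u_ne_zero k p), one_smul]

/-- The signed cyclic shift of the blocks. -/
def shift : X →L[ℂ] X :=
  opOf (fun n => (u (level n) (pos n) : ℂ)⁻¹ •
    if pos n + 1 < C (level n) then e (level n) (pos n + 1) else -e (level n) 0) 2 fun n => by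
    split_ifs with h
    · exact norm_inv_u_smul_e_le (depth_le_succ _ _)
    · rw [smul_neg, norm_neg]
      have h' : pos n = C (level n) - 1 := by have := pos_lt n; omega
      rw [h']
      exact norm_inv_u_smul_e_le (by rw [depth_last]; omega)

/-- The inverse of the signed cyclic shift. -/
def unshift : X →L[ℂ] X :=
  opOf (fun n => (u (level n) (pos n) : ℂ)⁻¹ •
    if pos n = 0 then -e (level n) (C (level n) - 1) else e (level n) (pos n - 1)) 2 fun n => by
    split_ifs with h
    · rw [smul_neg, norm_neg, h]
      exact norm_inv_u_smul_e_le (by rw [depth_zero]; omega)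
    · obtain ⟨p, hp⟩ := Nat.exists_eq_succ_of_ne_zero h
      rw [hp]
      exact norm_inv_u_smul_e_le (depth_succ_le _ _)

theorem norm_a_le (k : ℕ) : ‖a k‖ ≤ (1 / 4) ^ (k + 1) := (adm_a k).norm_le

theorem norm_a_le_sixteenth (k : ℕ) : ‖a k‖ ≤ 1 / 16 := by
  cases k with
  | zero => simp [a]
  | succ k =>
    refine (norm_a_le _).trans ?_
    calc (1 / 4 : ℝ) ^ (k + 1 + 1) ≤ (1 / 4) ^ 2 :=
          pow_le_pow_of_le_one (by norm_num) (by norm_num) (by omega)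
      _ = 1 / 16 := by norm_num

/-- The perturbation that makes each block emit a vector into lower blocks. -/
def emission : X →L[ℂ] X :=
  opOf (fun n => (u (level n) (pos n) : ℂ)⁻¹ •
    if pos n + 1 < C (level n) then 0 else a (level n)) (1 / 8) fun n => by
    split_ifs with h
    · simp
    · have h' : pos n = C (level n) - 1 := by have := pos_lt n; omega
      rw [h', norm_inv_u_smul, u_last]
      have := norm_a_le_sixteenth (level n)
      linarith

theorem shift_e {k p : ℕ} (h : p + 1 < C k) : shift (e k p) = e k (p + 1) := by
  have h' : p < C k := by omega
  refine apply_e_of_apply_b _ ?_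
  rw [shift, opOf_b, level_idx h', pos_idx h', if_pos h]

theorem shift_e_last (k : ℕ) : shift (e k (C k - 1)) = -e k 0 := by
  have h' : C k - 1 < C k := by have := C_pos k; omega
  refine apply_e_of_apply_b _ ?_
  rw [shift, opOf_b, level_idx h', pos_idx h', if_neg (by omega)]

theorem unshift_e {k p : ℕ} (h : p + 1 < C k) : unshift (e k (p + 1)) = e k p := by
  refine apply_e_of_apply_b _ ?_
  rw [unshift, opOf_b, level_idx h, pos_idx h, if_neg (by omega), Nat.add_sub_cancel]

theorem unshift_e_zero (k : ℕ) : unshift (e k 0) = -e k (C k - 1) := by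
  have h' : 0 < C k := C_pos k
  refine apply_e_of_apply_b _ ?_
  rw [unshift, opOf_b, level_idx h', pos_idx h', if_pos rfl]

theorem emission_e {k p : ℕ} (h : p + 1 < C k) : emission (e k p) = 0 := by
  have h' : p < C k := by omega
  refine apply_e_of_apply_b _ ?_
  rw [emission, opOf_b, level_idx h', pos_idx h', if_pos h]

theorem emission_e_last (k : ℕ) : emission (e k (C k - 1)) = a k := by
  have h' : C k - 1 < C k := by have := C_pos k; omega
  refine apply_e_of_apply_b _ ?_
  rw [emission, opOf_b, level_idx h', pos_idx h', if_neg (by omega)]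

theorem ext_e {L L' : X →L[ℂ] X} (h : ∀ k, ∀ p < C k, L (e k p) = L' (e k p)) : L = L' := by
  refine ext_basis fun n => ?_
  rw [b_eq, map_smul, map_smul, h _ _ (pos_lt n)]

theorem shift_mul_unshift : shift * unshift = 1 := by
  refine ext_e fun k p hp => ?_
  cases p with
  | zero => simp [unshift_e_zero, shift_e_last]
  | succ p => simp [unshift_e hp, shift_e hp]

theorem unshift_mul_shift : unshift * shift = 1 := by
  refine ext_e fun k p hp => ?_
  by_cases h : p + 1 < C k
  · simp [shift_e h, unshift_e h]
  · obtain rfl : p = C k - 1 := by omega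
    simp [shift_e_last, unshift_e_zero]

theorem isUnit_shift_add_emission : IsUnit (shift + emission) := by
  have h1 : IsUnit shift := ⟨⟨shift, unshift, shift_mul_unshift, unshift_mul_shift⟩, rfl⟩
  have h2 : ‖-(unshift * emission)‖ < 1 := by
    rw [norm_neg]
    have h3 : ‖unshift‖ ≤ 2 := norm_opOf_le _ _ _
    have h4 : ‖emission‖ ≤ 1 / 8 := norm_opOf_le _ _ _
    calc ‖unshift * emission‖ ≤ ‖unshift‖ * ‖emission‖ := norm_mul_le _ _
      _ ≤ 2 * (1 / 8) := mul_le_mul h3 h4 (norm_nonneg _) (by norm_num)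
      _ < 1 := by norm_num
  have h5 := h1.mul (isUnit_one_sub_of_norm_lt_one h2)
  rwa [sub_neg_eq_add, mul_add, mul_one, ← mul_assoc, shift_mul_unshift, one_mul] at h5

/-- The invertible operator of the construction. -/
def opEquiv : X ≃L[ℂ] X := ContinuousLinearEquiv.ofUnit isUnit_shift_add_emission.unit

/-- The operator of the construction. -/
def T : X →L[ℂ] X := opEquiv

/-- The inverse of the operator `T`. -/
def R : X →L[ℂ] X := opEquiv.symm

theorem T_eq : T = shift + emission := rfl

theorem T_e {k p : ℕ} (h : p + 1 < C k) : T (e k p) = e k (p + 1) := by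
  simp [T_eq, shift_e h, emission_e h]

theorem T_e_last (k : ℕ) : T (e k (C k - 1)) = -e k 0 + a k := by
  simp [T_eq, shift_e_last, emission_e_last]

theorem R_T (x : X) : R (T x) = x := opEquiv.symm_apply_apply x

theorem R_pow_T_pow (n : ℕ) (x : X) : (R ^ n) ((T ^ n) x) = x := by
  induction n with
  | zero => simp
  | succ n ih => rw [pow_succ, pow_succ', mul_apply_eq_comp,
      mul_apply_eq_comp, R_T, ih]

theorem R_e {k p : ℕ} (h : p + 1 < C k) : R (e k (p + 1)) = e k p := by
  rw [← T_e h, R_T]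

theorem R_e_zero (k : ℕ) : R (e k 0) = -e k (C k - 1) + R (a k) := by
  have h := congrArg R (T_e_last k)
  rw [R_T, map_add, map_neg] at h
  rw [h]; abel

theorem T_pow_e {k p : ℕ} (n : ℕ) (h : p + n < C k) : (T ^ n) (e k p) = e k (p + n) := by
  induction n with
  | zero => simp
  | succ n ih => rw [pow_succ', mul_apply_eq_comp, ih (by omega), T_e (by omega), add_assoc]

/-! ### Periodicity -/

theorem pow_add_apply (L : X →L[ℂ] X) (m n : ℕ) (x : X) :
    (L ^ (m + n)) x = (L ^ m) ((L ^ n) x) := by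
  rw [pow_add, mul_apply_eq_comp]

theorem T_pow_sub_e {k p : ℕ} (h : p < C k) :
    (T ^ (C k - p)) (e k p) = -e k 0 + a k := by
  obtain ⟨n, hn⟩ : ∃ n, C k - p = n + 1 := ⟨C k - p - 1, by omega⟩
  rw [hn, pow_succ', mul_apply_eq_comp, T_pow_e n (by omega),
    show p + n = C k - 1 by omega, T_e_last]

theorem T_pow_C_e {k p : ℕ} (h : p < C k) : (T ^ C k) (e k p) = -e k p + (T ^ p) (a k) := by
  have : C k = p + (C k - p) := by omega
  conv_lhs => rw [this]
  rw [pow_add_apply, T_pow_sub_e h, map_add, map_neg, T_pow_e p (by omega), zero_add]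

theorem pow_apply_eq_of_dvd {L : X →L[ℂ] X} {m n : ℕ} {x : X} (h : (L ^ m) x = x) (hd : m ∣ n) :
    (L ^ n) x = x := by
  obtain ⟨c, rfl⟩ := hd
  induction c with
  | zero => simp
  | succ c ih => rw [Nat.mul_succ, pow_add_apply, h, ih]

theorem T_pow_two_mul_C_e (k : ℕ) : ∀ p < C k, (T ^ (2 * C k)) (e k p) = e k p := by
  induction k using Nat.strong_induction_on with
  | _ k ih =>
    intro p hp
    have ha : (T ^ C k) (a k) = a k := by
      have := (adm_a k).map_eq (T ^ C k) (ContinuousLinearMap.id ℂ X) fun j hj q hq =>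
        pow_apply_eq_of_dvd (ih j hj q hq) (two_mul_C_dvd_C hj)
      simpa using this
    rw [two_mul, pow_add_apply, T_pow_C_e hp, map_add, map_neg, T_pow_C_e hp, ← pow_add_apply,
      add_comm (C k) p, pow_add_apply, ha]
    abel

theorem Adm.T_pow_eq {i n : ℕ} {μ : ℝ} {w : X} (h : Adm i μ w) (hn : ∀ j < i, 2 * C j ∣ n) :
    (T ^ n) w = w := by
  have := h.map_eq (T ^ n) (ContinuousLinearMap.id ℂ X) fun j hj p hp =>
    pow_apply_eq_of_dvd (T_pow_two_mul_C_e j p hp) (hn j hj)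
  simpa using this

theorem T_pow_C_a (k : ℕ) : (T ^ C k) (a k) = a k :=
  (adm_a k).T_pow_eq fun _ hj => two_mul_C_dvd_C hj

theorem R_pow_C_a (k : ℕ) : (R ^ C k) (a k) = a k := by
  conv_lhs => rw [← T_pow_C_a k]
  exact R_pow_T_pow _ _

theorem T_pow_N_y {k m : ℕ} (h : k ≤ m) : (T ^ N m) (y k) = y k :=
  (adm_y k).T_pow_eq fun _ _ => two_mul_C_dvd_N (by omega)

/-! ### Frequent hypercyclicity of `T` -/

/-- The part of the frequently hypercyclic vector in the block of level `k`. -/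
def seed (k : ℕ) : X := (lam k : ℂ) • e k (C k - N k)

/-- The frequently hypercyclic vector for `T`. -/
def fhcVector : X := ∑' k, seed k

/-- The bound on the contribution of level `k` to the error term. -/
def err (k : ℕ) : ℝ := lam k * (1 / 2) ^ 2 ^ k

theorem err_nonneg (k : ℕ) : 0 ≤ err k := by
  have := lam_pos k
  unfold err; positivity

theorem summable_err : Summable err := by
  have key : ∀ j ≥ 7, (j + 2) ^ 2 + j ≤ 2 ^ j := by
    intro j hj
    induction j, hj using Nat.le_induction with
    | base => norm_num
    | succ j hj ih => rw [pow_succ 2 j]; nlinarith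
  rw [← summable_nat_add_iff 7]
  refine Summable.of_nonneg_of_le (fun j => err_nonneg _) (fun j => ?_)
    ((summable_nat_add_iff 7).2 (summable_geometric_of_lt_one (r := (1 / 2 : ℝ))
      (by norm_num) (by norm_num)))
  have h1 : (1 / 2 : ℝ) ^ 2 ^ (j + 7) ≤ (1 / 2) ^ ((j + 7 + 2) ^ 2 + (j + 7)) :=
    pow_le_pow_of_le_one (by norm_num) (by norm_num) (key _ (by omega))
  calc err (j + 7) ≤ lam (j + 7) * (1 / 2) ^ ((j + 7 + 2) ^ 2 + (j + 7)) :=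
        mul_le_mul_of_nonneg_left h1 (lam_pos _).le
    _ = (1 / 2) ^ (j + 7) := by
      rw [lam, pow_add, ← mul_assoc, ← mul_pow]; norm_num

theorem norm_lam_smul_e_le {k p : ℕ} (h : 2 ^ k ≤ depth k p) :
    ‖(lam k : ℂ) • e k p‖ ≤ err k := by
  rw [norm_smul, norm_e, Complex.norm_real, Real.norm_of_nonneg (lam_pos k).le]
  exact mul_le_mul_of_nonneg_left (pow_le_pow_of_le_one (by norm_num) (by norm_num) h)
    (lam_pos k).le

theorem le_depth_right {k t m : ℕ} (h : t + m ≤ N k) : m ≤ depth k (C k - N k + t) := by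
  have := sixty_four_mul_N_le k
  unfold depth
  refine le_max_of_le_left (le_min ?_ ?_) <;> omega

theorem le_depth_left {k r m : ℕ} (h : N k / 2 + m ≤ r) (h' : r + m ≤ N k) :
    m ≤ depth k r := by
  unfold depth
  refine le_max_of_le_right (le_min ?_ ?_) <;> omega

theorem N_eq (k : ℕ) : N k = 16 * 2 ^ k := by unfold N; ring

theorem summable_seed : Summable seed := by
  refine Summable.of_norm_bounded summable_err fun k => norm_lam_smul_e_le ?_
  have := le_depth_right (k := k) (t := 0) (m := 2 ^ k) (by rw [N_eq]; omega)
  simpa using this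

theorem T_pow_sum_seed (k : ℕ) :
    (T ^ N k) (∑ j ∈ Finset.range (k + 1), seed j) = y k - (lam k : ℂ) • e k 0 := by
  have hs : ∀ k, (T ^ N k) (seed k) = (lam k : ℂ) • (-e k 0 + a k) := by
    intro k
    have h := sixty_four_mul_N_le k
    have h' := N_pos k
    have := T_pow_sub_e (k := k) (p := C k - N k) (by omega)
    rw [show C k - (C k - N k) = N k by omega] at this
    rw [seed, map_smul, this]
  induction k with
  | zero =>
    rw [Finset.sum_range_one, hs, y_zero]
    simp [a]
  | succ k ih =>
    have h := sixty_four_mul_N_le k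
    have h' := N_pos k
    have hl : (lam (k + 1) : ℂ) ≠ 0 := by exact_mod_cast (lam_pos _).ne'
    rw [Finset.sum_range_succ, map_add, hs]
    nth_rewrite 1 [N_succ]
    rw [two_mul, pow_add_apply, ih, map_sub, map_smul, T_pow_N_y le_rfl, T_pow_e _ (by omega),
      zero_add, smul_add, a, smul_smul, mul_inv_cancel₀ hl, one_smul, smul_neg]
    abel

theorem norm_T_pow_fhcVector_sub_le {k r : ℕ} (h : 10 * 2 ^ k ≤ r) (h' : r ≤ 14 * 2 ^ k)
    (hr : (T ^ r) (y k) = y k) :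
    ‖(T ^ (N k + r)) fhcVector - y k‖ ≤ ∑' j, err (j + k) := by
  have hN := N_eq k
  have hC := sixty_four_mul_N_le k
  have hpos : 0 < 2 ^ k := by positivity
  have hsplit : fhcVector = ∑ j ∈ Finset.range (k + 1), seed j + ∑' j, seed (j + (k + 1)) :=
    (summable_seed.sum_add_tsum_nat_add (k + 1)).symm
  have hse : Summable fun j => err (j + (k + 1)) := (summable_nat_add_iff (k + 1)).2 summable_err
  have htail : ‖(T ^ (N k + r)) (∑' j, seed (j + (k + 1)))‖ ≤ ∑' j, err (j + (k + 1)) := by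
    rw [ContinuousLinearMap.map_tsum _ ((summable_nat_add_iff (k + 1)).2 summable_seed)]
    refine tsum_of_norm_bounded hse.hasSum fun j => ?_
    have hj : 2 * 2 ^ k ≤ 2 ^ (j + (k + 1)) := by
      rw [← pow_succ']; exact Nat.pow_le_pow_right (by norm_num) (by omega)
    have hNj := N_eq (j + (k + 1))
    have hCj := sixty_four_mul_N_le (j + (k + 1))
    rw [seed, map_smul, T_pow_e _ (by omega)]
    exact norm_lam_smul_e_le (le_depth_right (by omega))
  have hfirst : (T ^ (N k + r)) (∑ j ∈ Finset.range (k + 1), seed j) =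
      y k - (lam k : ℂ) • e k r := by
    rw [add_comm, pow_add_apply, T_pow_sum_seed, map_sub, hr, map_smul, T_pow_e _ (by omega),
      zero_add]
  have hek : ‖(lam k : ℂ) • e k r‖ ≤ err k :=
    norm_lam_smul_e_le (le_depth_left (by omega) (by omega))
  have hsum : ∑' j, err (j + k) = err k + ∑' j, err (j + (k + 1)) := by
    rw [((summable_nat_add_iff k).2 summable_err).tsum_eq_zero_add]
    simp only [zero_add, add_assoc, add_comm 1 k]
  rw [hsplit, map_add, hfirst, hsum]
  calc _ = ‖(T ^ (N k + r)) (∑' j, seed (j + (k + 1))) - (lam k : ℂ) • e k r‖ := by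
        congr 1; abel
    _ ≤ _ := (norm_sub_le _ _).trans (by linarith)

theorem padicValNat_two_pow_mul (n l : ℕ) : padicValNat 2 (2 ^ n + 2 ^ (n + 1) * l) = n := by
  have : 2 ^ n + 2 ^ (n + 1) * l = 2 ^ n * (2 * l + 1) := by ring
  rw [this, padicValNat.mul (by positivity) (by omega), padicValNat.prime_pow,
    padicValNat.eq_zero_of_not_dvd (by omega), add_zero]

theorem le_card_visits {s k : ℕ} {U : Set X} (hk : s ≤ k)
    (h : ∀ r, 10 * 2 ^ k ≤ r → r ≤ 14 * 2 ^ k → 2 ^ s ∣ r → (T ^ (N k + r)) fhcVector ∈ U)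
    {M : ℕ} (hM : 32 * 2 ^ k ≤ M) :
    4 * 2 ^ k ≤ 2 ^ s * ((Finset.range M).filter fun n => (T ^ n) fhcVector ∈ U).card := by
  have hw : 2 ^ k = 2 ^ s * 2 ^ (k - s) := by rw [← pow_add]; congr 1; omega
  have hs : 0 < 2 ^ s := by positivity
  have hN := N_eq k
  have hpos : 0 < 2 ^ k := by positivity
  have hcard : (Finset.Icc (10 * 2 ^ (k - s)) (14 * 2 ^ (k - s))).card ≤
      ((Finset.range M).filter fun n => (T ^ n) fhcVector ∈ U).card := by
    refine Finset.card_le_card_of_injOn (fun c => N k + 2 ^ s * c) ?_ ?_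
    · intro c hc
      rw [Finset.mem_coe, Finset.mem_Icc] at hc
      have h1 : 10 * 2 ^ k ≤ 2 ^ s * c := by
        rw [hw]; calc _ = 2 ^ s * (10 * 2 ^ (k - s)) := by ring
          _ ≤ _ := Nat.mul_le_mul_left _ hc.1
      have h2 : 2 ^ s * c ≤ 14 * 2 ^ k := by
        rw [hw]; calc _ ≤ 2 ^ s * (14 * 2 ^ (k - s)) := Nat.mul_le_mul_left _ hc.2
          _ = _ := by ring
      rw [Finset.mem_coe, Finset.mem_filter, Finset.mem_range]
      have h3 : N k + 2 ^ s * c < M := by omega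
      exact ⟨h3, h _ h1 h2 (dvd_mul_right _ _)⟩
    · intro c _ c' _ hcc
      have : 2 ^ s * c = 2 ^ s * c' := by simpa using hcc
      exact Nat.eq_of_mul_eq_mul_left hs this
  rw [Nat.card_Icc] at hcard
  calc 4 * 2 ^ k = 2 ^ s * (4 * 2 ^ (k - s)) := by rw [hw]; ring
    _ ≤ _ := Nat.mul_le_mul_left _ (by omega)

theorem frequentlyHypercyclic_T : FrequentlyHypercyclic T := by
  refine ⟨fhcVector, fun U hU hne => ?_⟩
  obtain ⟨n, hn⟩ := denseRange_v.exists_mem_open hU hne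
  obtain ⟨ε, hε, hball⟩ := Metric.isOpen_iff.1 hU _ hn
  obtain ⟨i, μ, hadm⟩ := exists_adm_v n
  obtain ⟨K₁, hK₁⟩ := eventually_y_eq n
  obtain ⟨K₂, hK₂⟩ := Filter.eventually_atTop.1
    ((tendsto_sum_nat_add err).eventually (gt_mem_nhds hε))
  have hgood : ∀ k, K₁ ≤ k → K₂ ≤ k → padicValNat 2 k = n →
      ∀ r, 10 * 2 ^ k ≤ r → r ≤ 14 * 2 ^ k → 2 ^ (2 * i + 10) ∣ r →
        (T ^ (N k + r)) fhcVector ∈ U := by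
    intro k h1 h2 hkn r hr hr' hd
    have hy := hK₁ k h1 hkn
    have hT : (T ^ r) (y k) = y k := by
      rw [hy]
      exact hadm.T_pow_eq fun j hj => (two_mul_C_dvd_C hj).trans hd
    refine hball ?_
    rw [Metric.mem_ball, dist_eq_norm, ← hy]
    exact (norm_T_pow_fhcVector_sub_le hr hr' hT).trans_lt (hK₂ k h2)
  set s := 2 * i + 10 with hs
  set g := 2 ^ (n + 1) with hg
  have hgpos : 0 < g := by positivity
  have hc : (0 : ℝ) < 1 / (8 * 2 ^ s * 2 ^ g) := by positivity
  refine hc.trans_le (Filter.le_liminf_of_le ?_ ?_)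
  · refine (Filter.isBoundedUnder_of ⟨1, fun M => ?_⟩).isCoboundedUnder_ge
    refine div_le_one_of_le₀ ?_ M.cast_nonneg
    exact_mod_cast (Finset.card_filter_le _ _).trans (Finset.card_range M).le
  · filter_upwards [Filter.eventually_ge_atTop (2 ^ (K₁ + K₂ + s + g + 2 ^ n + 5))] with M hM
    have hM0 : M ≠ 0 := by rintro rfl; simp at hM
    set l := Nat.log 2 M with hl
    have hl1 : K₁ + K₂ + s + g + 2 ^ n + 5 ≤ l := by
      rw [hl]; exact (Nat.le_log_iff_pow_le (by norm_num) hM0).2 hM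
    have hl2 : 2 ^ l ≤ M := Nat.pow_log_le_self 2 hM0
    have hl3 : M < 2 ^ (l + 1) := Nat.lt_pow_succ_log_self (by norm_num) M
    set k := 2 ^ n + g * ((l - 5 - 2 ^ n) / g) with hk
    have hdm := Nat.div_add_mod (l - 5 - 2 ^ n) g
    have hmod := Nat.mod_lt (l - 5 - 2 ^ n) hgpos
    have hM1 : 32 * 2 ^ k ≤ M := by
      refine le_trans ?_ hl2
      calc 32 * 2 ^ k = 2 ^ (k + 5) := by ring
        _ ≤ 2 ^ l := Nat.pow_le_pow_right (by norm_num) (by omega)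
    have hM2 : M ≤ 32 * 2 ^ k * 2 ^ g := by
      refine hl3.le.trans ?_
      calc 2 ^ (l + 1) ≤ 2 ^ (k + 5 + g) := Nat.pow_le_pow_right (by norm_num) (by omega)
        _ = 32 * 2 ^ k * 2 ^ g := by ring
    have hcount := le_card_visits (s := s) (k := k) (U := U) (by omega)
      (hgood k (by omega) (by omega) (padicValNat_two_pow_mul _ _)) hM1
    have hMpos : (0 : ℝ) < M := by positivity
    rw [div_le_div_iff₀ (by positivity) hMpos]
    have h1 : (M : ℝ) ≤ 32 * 2 ^ k * 2 ^ g := by exact_mod_cast hM2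
    have h2 : (4 * 2 ^ k : ℝ) ≤
        2 ^ s * (((Finset.range M).filter fun n => (T ^ n) fhcVector ∈ U).card : ℝ) := by
      exact_mod_cast hcount
    have h3 : (0 : ℝ) < 8 * 2 ^ g := by positivity
    nlinarith [mul_le_mul_of_nonneg_left h2 h3.le]

/-! ### Orbits under `R` -/

theorem R_pow_e {k p s : ℕ} (hp : p < C k) (hs : s ≤ p) : (R ^ s) (e k p) = e k (p - s) := by
  induction s with
  | zero => simp
  | succ s ih =>
    rw [pow_succ', mul_apply_eq_comp, ih (by omega), show p - s = p - (s + 1) + 1 by omega,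
      R_e (by omega)]

theorem R_pow_succ_e_zero {k m : ℕ} (hm : m < C k) :
    (R ^ (m + 1)) (e k 0) = -e k (C k - (m + 1)) + (R ^ (m + 1)) (a k) := by
  induction m with
  | zero => simpa using R_e_zero k
  | succ m ih =>
    rw [pow_succ', mul_apply_eq_comp, ih (by omega), map_add, map_neg,
      show C k - (m + 1) = C k - (m + 1 + 1) + 1 by omega, R_e (by omega),
      mul_apply_eq_comp]

theorem R_pow_e_of_lt {k p s : ℕ} (hp : p < C k) (hs : p < s) (hs' : s ≤ p + C k) :
    (R ^ s) (e k p) = -e k (C k - (s - p)) + (R ^ (s - p)) (a k) := by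
  obtain ⟨m, rfl⟩ : ∃ m, s = m + 1 + p := ⟨s - p - 1, by omega⟩
  rw [pow_add_apply, R_pow_e hp le_rfl, Nat.sub_self, R_pow_succ_e_zero (by omega),
    Nat.add_sub_cancel]

theorem R_pow_e_cases {k p : ℕ} (hp : p < C k) (s : ℕ) :
    ∃ q < C k, (q + s) % C k = p ∧
      ((R ^ s) (e k p) = e k q ∨
        ∃ m, q + m = C k ∧ (R ^ s) (e k p) = -e k q + (R ^ m) (a k)) := by
  have hC := C_pos k
  induction s with
  | zero => exact ⟨p, hp, Nat.mod_eq_of_lt hp, Or.inl (by simp)⟩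
  | succ s ih =>
    obtain ⟨q, hq, hmod, h⟩ := ih
    cases q with
    | zero =>
      refine ⟨C k - 1, by omega, ?_, ?_⟩
      · rw [show C k - 1 + (s + 1) = 0 + s + C k by omega, Nat.add_mod_right, hmod]
      · rcases h with h | ⟨m, hm, h⟩
        · right
          refine ⟨1, by omega, ?_⟩
          rw [pow_succ', mul_apply_eq_comp, h, R_e_zero, pow_one]
        · left
          obtain rfl : m = C k := by omega
          rw [pow_succ', mul_apply_eq_comp, h, R_pow_C_a, map_add, map_neg, R_e_zero]
          abel
    | succ q =>
      refine ⟨q, by omega, by rw [← hmod]; congr 1; omega, ?_⟩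
      rcases h with h | ⟨m, hm, h⟩
      · left
        rw [pow_succ', mul_apply_eq_comp, h, R_e hq]
      · right
        refine ⟨m + 1, by omega, ?_⟩
        rw [pow_succ', mul_apply_eq_comp, h, map_add, map_neg, R_e hq, pow_succ' R m,
          mul_apply_eq_comp]

theorem norm_R_pow_e_le (k : ℕ) : ∀ p < C k, ∀ s, ‖(R ^ s) (e k p)‖ ≤ 2 := by
  induction k using Nat.strong_induction_on with
  | _ k ih =>
    intro p hp s
    have ha : ∀ m, ‖(R ^ m) (a k)‖ ≤ 1 := fun m => by
      refine ((adm_a k).norm_map_le (R ^ m) zero_le_two fun j hj q hq => ih j hj q hq m).trans ?_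
      have : (1 / 4 : ℝ) ^ k ≤ 1 := pow_le_one₀ (by norm_num) (by norm_num)
      rw [pow_succ]
      linarith
    obtain ⟨q, -, -, h | ⟨m, -, h⟩⟩ := R_pow_e_cases hp s
    · rw [h]; linarith [norm_e_le_one k q]
    · rw [h]
      refine (norm_add_le _ _).trans ?_
      rw [norm_neg]
      linarith [norm_e_le_one k q, ha m]

theorem norm_R_pow_a_le (k m : ℕ) : ‖(R ^ m) (a k)‖ ≤ (1 / 4) ^ k := by
  refine ((adm_a k).norm_map_le (R ^ m) zero_le_two
    fun j _ q hq => norm_R_pow_e_le j q hq m).trans ?_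
  have : (0 : ℝ) < (1 / 4) ^ k := by positivity
  rw [pow_succ]
  linarith

theorem Adm.R_pow_apply_eq_zero {i k q m : ℕ} {μ : ℝ} {w : X} (h : Adm k μ w)
    (hR : ∀ j < k, ∀ p < C j, (R ^ m) (InverseFHC.e j p) (idx i q) = 0) :
    (R ^ m) w (idx i q) = 0 := by
  have := h.map_eq ((ev (idx i q)).comp (R ^ m)) 0 fun j hj p hp => by simpa using hR j hj p hp
  simpa using this

theorem R_pow_e_apply_eq_zero (k : ℕ) : ∀ p < C k, ∀ s, ∀ i > k, ∀ q < C i,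
    (R ^ s) (e k p) (idx i q) = 0 := by
  induction k using Nat.strong_induction_on with
  | _ k ih =>
    intro p hp s i hi q hq
    have he : ∀ r < C k, e k r (idx i q) = 0 := fun r hr => by
      rw [e_apply hr hq, if_neg (by omega)]
    obtain ⟨r, hr, -, h | ⟨m, -, h⟩⟩ := R_pow_e_cases hp s
    · rw [h, he r hr]
    · rw [h, lp.coeFn_add, lp.coeFn_neg, Pi.add_apply, Pi.neg_apply, he r hr, neg_zero, zero_add]
      exact (adm_a k).R_pow_apply_eq_zero fun j hj p hp => ih j hj p hp m i (by omega) q hq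

theorem Adm.R_pow_apply_level_eq_zero {i k q m : ℕ} {μ : ℝ} {w : X} (h : Adm k μ w)
    (hik : k ≤ i) (hq : q < C i) : (R ^ m) w (idx i q) = 0 :=
  h.R_pow_apply_eq_zero fun j hj p hp => R_pow_e_apply_eq_zero j p hp m i (by omega) q hq

theorem R_pow_e_apply_same {k p q s : ℕ} (hp : p < C k) (hq : q < C k) :
    ‖(R ^ s) (e k p) (idx k q)‖ = if (q + s) % C k = p then u k q else 0 := by
  obtain ⟨r, hr, hmod, h⟩ := R_pow_e_cases hp s
  have h1 : ‖(R ^ s) (e k p) (idx k q)‖ = ‖e k r (idx k q)‖ := by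
    rcases h with h | ⟨m, -, h⟩
    · rw [h]
    · rw [h, lp.coeFn_add, lp.coeFn_neg, Pi.add_apply, Pi.neg_apply,
        (adm_a k).R_pow_apply_level_eq_zero le_rfl hq, add_zero, norm_neg]
  have hiff : (q + s) % C k = p ↔ q = r := by
    constructor
    · intro h2
      have h3 : q + s ≡ r + s [MOD C k] := h2.trans hmod.symm
      exact (Nat.ModEq.add_right_cancel' s h3).eq_of_lt_of_lt hq hr
    · rintro rfl; exact hmod
  rw [h1, e_apply hr hq]
  by_cases h4 : q = r
  · rw [if_pos ⟨rfl, h4⟩, if_pos (hiff.2 h4), Complex.norm_real,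
      Real.norm_of_nonneg (u_pos k r).le, h4]
  · rw [if_neg (fun h5 => h4 h5.2), if_neg (fun h5 => h4 (hiff.1 h5)), norm_zero]

/-- The position reached from position `p` of the block of level `k` after `t` steps of `R`. -/
def back (k p t : ℕ) : ℕ := if t ≤ p then p - t else p + C k - t

theorem back_lt {k p t : ℕ} (hp : p < C k) : back k p t < C k := by
  unfold back; split_ifs <;> omega

theorem back_add_mod {k p t : ℕ} (hp : p < C k) (ht : t < C k) : (back k p t + t) % C k = p := by
  unfold back
  split_ifs
  · rw [show p - t + t = p by omega, Nat.mod_eq_of_lt hp]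
  · rw [show p + C k - t + t = p + C k by omega, Nat.add_mod_right, Nat.mod_eq_of_lt hp]

theorem R_pow_a_succ_apply_eq_zero {i k q s : ℕ} (hi : 4 * N (k + 1) ≤ C i) (hq : q < C i)
    (h : (R ^ s) (e k (N k)) (idx i q) = 0) : (R ^ s) (a (k + 1)) (idx i q) = 0 := by
  have hy : ∀ m ≤ k + 1, (R ^ s) (y m) (idx i q) = 0 := by
    intro m hm
    refine (adm_y m).R_pow_apply_eq_zero fun j hj p hp => ?_
    have h1 : 2 * C j ≤ N (k + 1) :=
      Nat.le_of_dvd (N_pos _) (two_mul_C_dvd_N (by omega))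
    have h2 := C_pos j
    refine R_pow_e_apply_eq_zero j p hp s i ?_ q hq
    by_contra hc
    have := C_mono (not_lt.1 hc)
    omega
  change ev (idx i q) ((R ^ s) (a (k + 1))) = 0
  rw [a, map_smul, map_add, map_sub, map_smul, map_smul, map_add, map_sub, map_smul]
  simp only [ev_apply, hy k (by omega), hy (k + 1) le_rfl, h, smul_zero, sub_zero, add_zero]

theorem R_pow_e_N_apply_eq_zero {i p t : ℕ} (hp : p < C i) (hd : depth i p ≠ 0)
    (ht : 8 * t < C i) {k : ℕ} (hik : i ≤ k) (hk : 4 * N k ≤ C i) :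
    ∀ τ, N i ≤ τ → τ ≤ t → (R ^ (t - τ)) (e k (N k)) (idx i (back i p t)) = 0 := by
  induction k, hik using Nat.le_induction with
  | base =>
    intro τ hτ hτt
    have hN := sixty_four_mul_N_le i
    have hNpos := N_pos i
    rw [← norm_eq_zero, R_pow_e_apply_same (by omega) (back_lt hp), if_neg]
    intro hmod
    have h1 := back_add_mod (t := t) hp (by omega)
    have h2 : (N i + τ) % C i = p := by
      rw [← h1, ← hmod, Nat.mod_add_mod]
      congr 1; omega
    rw [Nat.mod_eq_of_lt (by omega)] at h2
    apply hd
    unfold depth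
    rw [show p - (C i - 2 * N i) = 0 by omega, show N i - p = 0 by omega]
    simp
  | succ k hik ih =>
    intro τ hτ hτt
    have hlt := back_lt (t := t) hp
    have hN := sixty_four_mul_N_le (k + 1)
    have hNpos := N_pos (k + 1)
    have hC := C_mono (show i ≤ k + 1 by omega)
    have he : ∀ r < C (k + 1), e (k + 1) r (idx i (back i p t)) = 0 := fun r hr => by
      rw [e_apply hr hlt, if_neg (by omega)]
    rcases le_or_gt (t - τ) (N (k + 1)) with hle | hgt
    · rw [R_pow_e (by omega) hle, he _ (by omega)]
    · rw [R_pow_e_of_lt (by omega) hgt (by omega), lp.coeFn_add, lp.coeFn_neg, Pi.add_apply,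
        Pi.neg_apply, he _ (by omega), neg_zero, zero_add]
      refine R_pow_a_succ_apply_eq_zero hk hlt ?_
      rw [Nat.sub_sub]
      refine ih ?_ _ (by omega) (by omega)
      have := N_mono (show k ≤ k + 1 by omega)
      omega

theorem R_pow_e_apply_back_eq_zero {i p t : ℕ} (hp : p < C i) (hd : depth i p ≠ 0)
    (ht : 8 * t < C i) {k p' : ℕ} (hik : i < k) (hp' : p' < C k) (hd' : depth k p' ≠ 0) :
    (R ^ t) (e k p') (idx i (back i p t)) = 0 := by
  have hlt := back_lt (t := t) hp
  have he : ∀ r < C k, e k r (idx i (back i p t)) = 0 := fun r hr => by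
    rw [e_apply hr hlt, if_neg (by omega)]
  rcases le_or_gt t p' with hle | hgt
  · rw [R_pow_e hp' hle, he _ (by omega)]
  · have hC := four_mul_C_le hik
    have hNk := sixty_four_mul_N_le k
    obtain ⟨k, rfl⟩ : ∃ k', k = k' + 1 := ⟨k - 1, by omega⟩
    have hNs := N_succ k
    have hp'' : N k < p' := by
      by_contra hc
      apply hd'
      unfold depth
      rw [show p' - (C (k + 1) - 2 * N (k + 1)) = 0 by omega,
        show p' - N (k + 1) / 2 = 0 by omega]
      simp
    have hNi := N_mono (show i ≤ k by omega)
    rw [R_pow_e_of_lt hp' hgt (by omega), lp.coeFn_add, lp.coeFn_neg, Pi.add_apply,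
      Pi.neg_apply, he _ (by omega), neg_zero, zero_add]
    refine R_pow_a_succ_apply_eq_zero (by omega) hlt ?_
    exact R_pow_e_N_apply_eq_zero hp hd ht (by omega) (by omega) p' (by omega) hgt.le

/-! ### The inverse is not frequently hypercyclic -/

/-- The modulus of the coefficient of `x` on `e k p`. -/
def coeff (x : X) (k p : ℕ) : ℝ := ‖x (idx k p)‖ / u k p

theorem coeff_nonneg (x : X) (k p : ℕ) : 0 ≤ coeff x k p :=
  div_nonneg (norm_nonneg _) (u_pos k p).le

/-- The positions of the block of level `k` with weight less than one. -/
def light (k : ℕ) : Finset ℕ := (Finset.range (C k)).filter fun p => depth k p ≠ 0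

theorem mem_light {k p : ℕ} : p ∈ light k ↔ p < C k ∧ depth k p ≠ 0 := by simp [light]

theorem card_light_le (k : ℕ) : (light k).card ≤ 3 * N k := by
  have hN := sixty_four_mul_N_le k
  have hsub : light k ⊆ Finset.Ico (C k - 2 * N k) (C k) ∪ Finset.range (N k) := by
    intro p hp
    obtain ⟨hp, hd⟩ := mem_light.1 hp
    rw [Finset.mem_union, Finset.mem_Ico, Finset.mem_range]
    by_contra hc
    apply hd
    unfold depth
    rw [show p - (C k - 2 * N k) = 0 by omega, show N k - p = 0 by omega]
    simp
  refine (Finset.card_le_card hsub).trans ((Finset.card_union_le _ _).trans ?_)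
  rw [Nat.card_Ico, Finset.card_range]
  omega

theorem sum_norm_apply_idx_le (z : X) {k : ℕ} {s : Finset ℕ} {f : ℕ → ℕ}
    (hf : ∀ p ∈ s, f p < C k) (hinj : Set.InjOn f s) :
    ∑ p ∈ s, ‖z (idx k (f p))‖ ≤ ‖z‖ := by
  have h : Set.InjOn (fun p => idx k (f p)) s := fun p hp p' hp' hpp =>
    hinj hp hp' ((idx_inj (hf p hp) (hf p' hp')).1 hpp).2
  rw [← Finset.sum_image (f := fun n => ‖z n‖) h]
  exact sum_norm_apply_le z _

theorem back_injOn {k t : ℕ} (ht : t < C k) : Set.InjOn (fun p => back k p t) (light k) := by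
  intro p hp p' hp' h
  have h1 := (mem_light.1 hp).1
  have h2 := (mem_light.1 hp').1
  rw [← back_add_mod h1 ht, ← back_add_mod h2 ht]
  exact congrArg (fun q => (q + t) % C k) h

/-- The indices of level greater than `i` with weight one. -/
def heavyAbove (i : ℕ) : Set ℕ := {n | i < level n ∧ depth (level n) (pos n) = 0}

/-- The indices of level `i`. -/
def block (i : ℕ) : Set ℕ := {n | level n = i}

theorem norm_proj_R_pow_le (x : X) (i t : ℕ) :
    ‖proj (block i) ((R ^ t) (proj (heavyAbove i) x))‖ ≤ (1 / 4) ^ i * ‖x‖ := by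
  refine le_trans (norm_map_le ((proj (block i)).comp (R ^ t)) (proj (heavyAbove i) x)
    ((1 / 4) ^ i) fun n hn => ?_) (mul_le_mul_of_nonneg_left (norm_proj_apply_le _ _)
      (by positivity))
  have hmem : n ∈ heavyAbove i := by
    by_contra hc
    rw [proj_apply, if_neg hc] at hn
    exact hn rfl
  obtain ⟨hi, hd⟩ := hmem
  have hb : b n = e (level n) (pos n) := by
    rw [b_eq, u, hd]; simp
  have hproj : ∀ q < C (level n), proj (block i) (e (level n) q) = 0 := fun q hq => by
    rw [e, map_smul, proj_b, if_neg, smul_zero]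
    intro hc
    have : level (idx (level n) q) = i := hc
    rw [level_idx hq] at this
    omega
  rw [ContinuousLinearMap.comp_apply, hb]
  obtain ⟨q, hq, -, h | ⟨m, -, h⟩⟩ := R_pow_e_cases (pos_lt n) t
  · rw [h, hproj q hq, norm_zero]; positivity
  · rw [h, map_add, map_neg, hproj q hq, neg_zero, zero_add]
    refine (norm_proj_apply_le _ _).trans ((norm_R_pow_a_le _ _).trans ?_)
    exact pow_le_pow_of_le_one (by norm_num) (by norm_num) hi.le

theorem norm_R_pow_sub_apply_back {x : X} {i p t : ℕ} (hp : p ∈ light i) (ht : 8 * t < C i)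
    (hb : depth i (back i p t) = 0) :
    ‖(R ^ t) (x - proj (heavyAbove i) x) (idx i (back i p t))‖ = coeff x i p := by
  obtain ⟨hpC, hd⟩ := mem_light.1 hp
  have hlt := back_lt (t := t) hpC
  have hu : u i (back i p t) = 1 := by simp [u, hb]
  have hz : ∀ n, (x - proj (heavyAbove i) x) n = if n ∈ heavyAbove i then 0 else x n := by
    intro n
    rw [lp.coeFn_sub, Pi.sub_apply, proj_apply]
    split_ifs <;> simp
  have hE : ∀ n, (R ^ t) (b n) (idx i (back i p t)) = (u (level n) (pos n) : ℂ)⁻¹ *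
      (R ^ t) (e (level n) (pos n)) (idx i (back i p t)) := by
    intro n
    conv_lhs => rw [b_eq n, map_smul]
    rfl
  have h := map_eq_of_single ((ev (idx i (back i p t))).comp (R ^ t))
    (x - proj (heavyAbove i) x) (idx i p) (fun n hn hne => by
      rw [hz] at hne
      change (R ^ t) (b n) (idx i (back i p t)) = 0
      rw [hE, mul_eq_zero]
      right
      rcases lt_trichotomy (level n) i with hlev | hlev | hlev
      · exact R_pow_e_apply_eq_zero _ _ (pos_lt n) t i hlev _ hlt
      · have hpn := pos_lt n
        rw [hlev] at hpn
        rw [hlev, ← norm_eq_zero, R_pow_e_apply_same hpn hlt,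
          back_add_mod hpC (by omega), if_neg]
        rintro rfl
        rw [← hlev, idx_level_pos] at hn
        exact hn rfl
      · refine R_pow_e_apply_back_eq_zero hpC hd ht hlev (pos_lt n) fun hd0 => ?_
        rw [if_pos ⟨hlev, hd0⟩] at hne
        exact hne rfl)
  change (R ^ t) (x - proj (heavyAbove i) x) (idx i (back i p t)) =
    _ * (R ^ t) (b (idx i p)) (idx i (back i p t)) at h
  rw [h, hz, if_neg, hE, level_idx hpC, pos_idx hpC, norm_mul, norm_mul,
    R_pow_e_apply_same hpC hlt, if_pos (back_add_mod hpC (by omega)), norm_inv,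
    Complex.norm_real, Real.norm_of_nonneg (u_pos i p).le, hu, mul_one, coeff, div_eq_mul_inv]
  · intro hc
    have : i < level (idx i p) := hc.1
    rw [level_idx hpC] at this
    omega

theorem sum_coeff_back_le (x : X) {i t : ℕ} (ht : 8 * t < C i) :
    ∑ p ∈ (light i).filter (fun p => depth i (back i p t) = 0), coeff x i p ≤
      ‖(R ^ t) x‖ + (1 / 4) ^ i * ‖x‖ := by
  set s := (light i).filter (fun p => depth i (back i p t) = 0) with hs
  have hsub : s ⊆ light i := Finset.filter_subset _ _
  have hlt : ∀ p ∈ s, back i p t < C i := fun p hp => back_lt (mem_light.1 (hsub hp)).1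
  have hinj : Set.InjOn (fun p => back i p t) s :=
    (back_injOn (by omega)).mono (by exact_mod_cast hsub)
  have h1 := sum_norm_apply_idx_le ((R ^ t) x) hlt hinj
  have h2 := (sum_norm_apply_idx_le (proj (block i) ((R ^ t) (proj (heavyAbove i) x)))
    hlt hinj).trans (norm_proj_R_pow_le x i t)
  refine le_trans ?_ (add_le_add h1 h2)
  rw [← Finset.sum_add_distrib]
  refine Finset.sum_le_sum fun p hp => ?_
  have hmem : idx i (back i p t) ∈ block i := level_idx (hlt p hp)
  rw [← norm_R_pow_sub_apply_back (hsub hp) ht (Finset.mem_filter.1 hp).2, proj_apply,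
    if_pos hmem, map_sub, lp.coeFn_sub, Pi.sub_apply]
  exact norm_sub_le _ _

theorem card_filter_back_le {i p : ℕ} (hp : p < C i) {V : Finset ℕ}
    (hV : ∀ t ∈ V, t < C i) :
    (V.filter fun t => ¬depth i (back i p t) = 0).card ≤ 3 * N i := by
  refine le_trans (Finset.card_le_card_of_injOn (fun t => back i p t) ?_ ?_) (card_light_le i)
  · intro t ht
    rw [Finset.mem_coe, Finset.mem_filter] at ht
    exact mem_light.2 ⟨back_lt hp, ht.2⟩
  · intro t ht t' ht' h
    have h1 := hV t (Finset.mem_filter.1 (Finset.mem_coe.1 ht)).1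
    have h2 := hV t' (Finset.mem_filter.1 (Finset.mem_coe.1 ht')).1
    simp only [back] at h
    split_ifs at h <;> omega

theorem sum_coeff_light_le {x : X} {i : ℕ} {V : Finset ℕ} (hV : ∀ t ∈ V, 8 * t < C i)
    (hcard : 6 * N i ≤ V.card) {B : ℝ}
    (hB : ∀ t ∈ V, ‖(R ^ t) x‖ + (1 / 4) ^ i * ‖x‖ ≤ B) :
    ∑ p ∈ light i, coeff x i p ≤ 2 * B := by
  have hpos : (0 : ℝ) < V.card := by
    have := N_pos i
    exact_mod_cast (by omega : 0 < V.card)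
  have h1 : ∑ t ∈ V, ∑ p ∈ light i, (if depth i (back i p t) = 0 then coeff x i p else 0) ≤
      V.card * B := by
    rw [← nsmul_eq_mul]
    refine Finset.sum_le_card_nsmul _ _ _ fun t ht => ?_
    rw [← Finset.sum_filter]
    exact (sum_coeff_back_le x (hV t ht)).trans (hB t ht)
  have h2 : ∑ p ∈ light i, (V.card / 2 : ℝ) * coeff x i p ≤
      ∑ t ∈ V, ∑ p ∈ light i, (if depth i (back i p t) = 0 then coeff x i p else 0) := by
    rw [Finset.sum_comm]
    refine Finset.sum_le_sum fun p hp => ?_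
    rw [← Finset.sum_filter, Finset.sum_const, nsmul_eq_mul]
    refine mul_le_mul_of_nonneg_right ?_ (coeff_nonneg _ _ _)
    have h3 := card_filter_back_le (mem_light.1 hp).1 (V := V)
      fun t ht => by have := hV t ht; omega
    have h4 := Finset.card_filter_add_card_filter_not (s := V)
      (fun t => depth i (back i p t) = 0)
    have h5 : V.card ≤ 2 * (V.filter fun t => depth i (back i p t) = 0).card := by omega
    have h6 : (V.card : ℝ) ≤ 2 * ((V.filter fun t => depth i (back i p t) = 0).card : ℝ) := by
      exact_mod_cast h5
    linarith
  rw [← Finset.mul_sum] at h2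
  have h7 : (V.card : ℝ) * (∑ p ∈ light i, coeff x i p) ≤ V.card * (2 * B) := by linarith
  exact le_of_mul_le_mul_left h7 hpos

theorem sum_coeff_block_le (x : X) (i : ℕ) :
    ∑ p ∈ Finset.range (C i), coeff x i p ≤ ∑ p ∈ light i, coeff x i p + ‖x‖ := by
  rw [← Finset.sum_filter_add_sum_filter_not (Finset.range (C i)) (fun p => depth i p ≠ 0)]
  refine add_le_add le_rfl ?_
  have h := sum_norm_apply_idx_le x (k := i)
    (s := (Finset.range (C i)).filter fun p => ¬depth i p ≠ 0) (f := id)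
    (fun p hp => Finset.mem_range.1 (Finset.mem_filter.1 hp).1) (Set.injOn_id _)
  refine le_trans (Finset.sum_le_sum fun p hp => ?_) h
  have hd : depth i p = 0 := not_not.1 (Finset.mem_filter.1 hp).2
  simp [coeff, u, hd]

theorem norm_apply_R_pow_e_le {i k p : ℕ} (hp : p < C k) (hik : i ≤ k) (t : ℕ) :
    ‖(R ^ t) (e k p) (idx i 0)‖ ≤ 2 ^ i * (1 / 2) ^ k := by
  rcases hik.eq_or_lt with rfl | hlt
  · rw [R_pow_e_apply_same hp (C_pos _), ← mul_pow]
    split_ifs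
    · refine (u_le_one _ _).trans ?_; norm_num
    · norm_num
  · have h4 : (1 / 4 : ℝ) ^ k ≤ 2 ^ i * (1 / 2) ^ k := by
      have h1 : (1 / 4 : ℝ) ^ k ≤ (1 / 2) ^ k := pow_le_pow_left₀ (by norm_num) (by norm_num) k
      have h2 : (1 : ℝ) ≤ 2 ^ i := one_le_pow₀ one_le_two
      have h3 : (0 : ℝ) < (1 / 2) ^ k := by positivity
      nlinarith
    have he : ∀ q < C k, e k q (idx i 0) = 0 := fun q hq => by
      rw [e_apply hq (C_pos i), if_neg (by omega)]
    obtain ⟨q, hq, -, h | ⟨m, -, h⟩⟩ := R_pow_e_cases hp t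
    · rw [h, he q hq, norm_zero]; positivity
    · rw [h, lp.coeFn_add, lp.coeFn_neg, Pi.add_apply, Pi.neg_apply, he q hq, neg_zero, zero_add]
      exact (norm_apply_le _ _).trans ((norm_R_pow_a_le _ _).trans h4)

theorem norm_R_pow_apply_le {x : X} {i : ℕ} {M : ℝ}
    (hM : ∀ k ≥ i, ∑ p ∈ Finset.range (C k), coeff x k p ≤ M) (t : ℕ) :
    ‖(R ^ t) x (idx i 0)‖ ≤ 2 * 2 ^ i * M := by
  have hM0 : 0 ≤ M := (Finset.sum_nonneg fun p _ => coeff_nonneg x i p).trans (hM i le_rfl)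
  have hsum := (hasSum_map ((ev (idx i 0)).comp (R ^ t)) x).norm
  refine le_of_tendsto hsum (Filter.Eventually.of_forall fun s => ?_)
  refine (norm_sum_le _ _).trans ?_
  have hterm : ∀ n, ‖x n • ((ev (idx i 0)).comp (R ^ t)) (b n)‖ ≤
      if i ≤ level n then 2 ^ i * (1 / 2) ^ level n * coeff x (level n) (pos n) else 0 := by
    intro n
    have hE : ‖x n • ((ev (idx i 0)).comp (R ^ t)) (b n)‖ = coeff x (level n) (pos n) *
        ‖(R ^ t) (e (level n) (pos n)) (idx i 0)‖ := by
      conv_lhs => rw [b_eq n, map_smul]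
      rw [norm_smul, norm_smul, norm_inv, Complex.norm_real,
        Real.norm_of_nonneg (u_pos _ _).le, coeff, idx_level_pos, ← mul_assoc, div_eq_mul_inv]
      rfl
    rw [hE]
    split_ifs with h
    · rw [mul_comm]
      exact mul_le_mul_of_nonneg_right (norm_apply_R_pow_e_le (pos_lt n) h t)
        (coeff_nonneg _ _ _)
    · rw [R_pow_e_apply_eq_zero _ _ (pos_lt n) t i (not_le.1 h) 0 (C_pos i), norm_zero, mul_zero]
  refine (Finset.sum_le_sum fun n _ => hterm n).trans ?_
  obtain ⟨L, hL⟩ : ∃ L, ∀ n ∈ s, level n ∈ Finset.range L := by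
    refine ⟨s.sup level + 1, fun n hn => Finset.mem_range.2 ?_⟩
    exact Nat.lt_succ_of_le (Finset.le_sup hn)
  rw [← Finset.sum_fiberwise_of_maps_to hL]
  have hinner : ∀ k, ∑ n ∈ s.filter (fun n => level n = k),
      (if i ≤ level n then 2 ^ i * (1 / 2) ^ level n * coeff x (level n) (pos n) else 0) ≤
        2 ^ i * M * (1 / 2) ^ k := by
    intro k
    by_cases hk : i ≤ k
    · have hcongr : ∀ n ∈ s.filter (fun n => level n = k),
          (if i ≤ level n then 2 ^ i * (1 / 2 : ℝ) ^ level n * coeff x (level n) (pos n) else 0) =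
            2 ^ i * (1 / 2) ^ k * coeff x k (pos n) := by
        intro n hn
        rw [(Finset.mem_filter.1 hn).2, if_pos hk]
      rw [Finset.sum_congr rfl hcongr, ← Finset.mul_sum]
      have hinj : Set.InjOn pos (s.filter (fun n => level n = k)) := by
        intro n hn m hm h
        rw [← idx_level_pos n, ← idx_level_pos m, (Finset.mem_filter.1 (Finset.mem_coe.1 hn)).2,
          (Finset.mem_filter.1 (Finset.mem_coe.1 hm)).2, h]
      have hle : ∑ n ∈ s.filter (fun n => level n = k), coeff x k (pos n) ≤ M := by
        rw [← Finset.sum_image (f := fun p => coeff x k p) hinj]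
        refine le_trans (Finset.sum_le_sum_of_subset_of_nonneg ?_
          fun p _ _ => coeff_nonneg x k p) (hM k hk)
        intro p hp
        obtain ⟨n, hn, rfl⟩ := Finset.mem_image.1 hp
        rw [Finset.mem_range, ← (Finset.mem_filter.1 hn).2]
        exact pos_lt n
      have := mul_le_mul_of_nonneg_left hle (show (0 : ℝ) ≤ 2 ^ i * (1 / 2) ^ k by positivity)
      linarith
    · rw [Finset.sum_eq_zero]
      · positivity
      · intro n hn
        rw [(Finset.mem_filter.1 hn).2, if_neg hk]
  refine (Finset.sum_le_sum fun k _ => hinner k).trans ?_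
  rw [← Finset.mul_sum]
  have := mul_le_mul_of_nonneg_left (sum_geometric_two_le L)
    (show (0 : ℝ) ≤ 2 ^ i * M by positivity)
  linarith

theorem exists_sum_coeff_light_le {x : X}
    (hx : 0 < Filter.liminf (fun N : ℕ =>
      (((Finset.range N).filter (fun n => (R ^ n) x ∈ Metric.ball (0 : X) 1)).card : ℝ) / N)
        Filter.atTop) :
    ∃ K, ∀ i ≥ K, ∑ p ∈ light i, coeff x i p ≤ 4 := by
  obtain ⟨δ, hδ, hlt⟩ := exists_between hx
  have hev := Filter.eventually_lt_of_lt_liminf hlt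
    (Filter.isBoundedUnder_of ⟨0, fun M => by positivity⟩)
  obtain ⟨M₀, hM₀⟩ := Filter.eventually_atTop.1 hev
  obtain ⟨K₁, hK₁⟩ := pow_unbounded_of_one_lt (6 / δ) one_lt_two
  obtain ⟨K₂, hK₂⟩ := pow_unbounded_of_one_lt ‖x‖ one_lt_two
  refine ⟨M₀ + K₁ + K₂, fun i hi => ?_⟩
  set H := 2 ^ (i + 3) * N i with hH
  have hHC : C i = 8 * H := by rw [C_eq, hH]; ring
  have hNpos := N_pos i
  have hHM : M₀ ≤ H := by
    have h1 : i + 3 < 2 ^ (i + 3) := Nat.lt_two_pow_self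
    have h2 : 2 ^ (i + 3) ≤ H := Nat.le_mul_of_pos_right _ hNpos
    omega
  have hdens := hM₀ H hHM
  have hHpos : (0 : ℝ) < H := by
    have : 0 < H := by positivity
    exact_mod_cast this
  rw [lt_div_iff₀ hHpos] at hdens
  set V := (Finset.range H).filter (fun n => (R ^ n) x ∈ Metric.ball (0 : X) 1) with hV
  have hcard : 6 * N i ≤ V.card := by
    have h1 : (2 : ℝ) ^ K₁ ≤ 2 ^ (i + 3) := pow_le_pow_right₀ one_le_two (by omega)
    have h2 : 6 ≤ δ * 2 ^ (i + 3) := by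
      rw [div_lt_iff₀ hδ] at hK₁
      nlinarith
    have h3 : (6 * N i : ℝ) ≤ V.card := by
      have h4 : (H : ℝ) = 2 ^ (i + 3) * N i := by rw [hH]; push_cast; ring
      have h5 : (0 : ℝ) ≤ N i := Nat.cast_nonneg _
      rw [h4] at hdens
      nlinarith
    exact_mod_cast h3
  have hB := sum_coeff_light_le (x := x) (i := i) (V := V) (B := 2) (fun t ht => by
      have := Finset.mem_range.1 (Finset.mem_filter.1 ht).1
      omega) hcard (fun t ht => by
      have h1 := (Finset.mem_filter.1 ht).2
      rw [mem_ball_zero_iff] at h1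
      have h2 : (1 / 4 : ℝ) ^ i * ‖x‖ ≤ 1 := by
        have h3 : ‖x‖ ≤ 4 ^ i := hK₂.le.trans
          ((pow_le_pow_right₀ one_le_two (show K₂ ≤ i by omega)).trans
            (pow_le_pow_left₀ (by norm_num) (by norm_num) i))
        rw [one_div, inv_pow, inv_mul_le_iff₀ (by positivity), mul_one]
        exact h3
      linarith)
  linarith

theorem not_frequentlyHypercyclic_R : ¬FrequentlyHypercyclic R := by
  rintro ⟨x, hx⟩
  obtain ⟨K, hK⟩ := exists_sum_coeff_light_le
    (hx (Metric.ball 0 1) Metric.isOpen_ball (Metric.nonempty_ball.2 one_pos))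
  have hbound := norm_R_pow_apply_le (x := x) (i := K) (M := 4 + ‖x‖) fun k hk =>
    (sum_coeff_block_le x k).trans (by linarith [hK k hk])
  set A : ℝ := 2 * 2 ^ K * (4 + ‖x‖) with hA
  have hA0 : 0 ≤ A := by positivity
  have hopen : IsOpen {z : X | A < ‖z (idx K 0)‖} :=
    isOpen_lt continuous_const (ev (idx K 0)).continuous.norm
  have hne : {z : X | A < ‖z (idx K 0)‖}.Nonempty := by
    refine ⟨((A + 1 : ℝ) : ℂ) • b (idx K 0), ?_⟩
    change A < ‖((A + 1 : ℝ) : ℂ) * b (idx K 0) (idx K 0)‖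
    rw [b_apply, if_pos rfl, mul_one, Complex.norm_real, Real.norm_of_nonneg (by linarith)]
    linarith
  have h := hx _ hopen hne
  have hempty : ∀ M : ℕ, (Finset.range M).filter
      (fun n => (R ^ n) x ∈ {z : X | A < ‖z (idx K 0)‖}) = ∅ := fun M =>
    Finset.filter_eq_empty_iff.2 fun n _ => not_lt.2 (hbound n)
  simp only [hempty, Finset.card_empty, Nat.cast_zero, zero_div, Filter.liminf_const,
    lt_self_iff_false] at h

end InverseFHC

/-- There exists a continuous linear operator on `ℓ¹(ℕ)` which is bijective with continuous
inverse, frequently hypercyclic, and whose inverse is not frequently hypercyclic. -/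
theorem exists_invertible_frequentlyHypercyclic_inverse_not :
    ∃ T : X ≃L[ℂ] X,
      FrequentlyHypercyclic (T : X →L[ℂ] X) ∧
      ¬ FrequentlyHypercyclic (T.symm : X →L[ℂ] X) :=
  ⟨InverseFHC.opEquiv, InverseFHC.frequentlyHypercyclic_T, InverseFHC.not_frequentlyHypercyclic_R⟩
end
end

section
/- For every n ≥ 0 and every x ∈ span{e_k : k < b_{n+1}}, T̃^{2(b_{n+1}−b_n)} x = 2^{−2η_n} x. -/
open scoped Classical

noncomputable section

/-- The canonical basis `(e_k)` of `ℓ¹(ℕ)`. -/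
noncomputable def e (k : ℕ) : X := lp.single 1 k 1

/-- If `f ^ a` acts on `x` as the scalar `c`, then `f ^ (a * m)` acts on `x` as `c ^ m`. -/
lemma pow_mul_apply_eq_smul {E : Type*} [NormedAddCommGroup E] [NormedSpace ℂ E]
    (f : E →L[ℂ] E) {x : E} {a : ℕ} {c : ℂ} (h : (f ^ a) x = c • x) (m : ℕ) :
    (f ^ (a * m)) x = c ^ m • x := by
  induction m with
  | zero => simp
  | succ m ih =>
    rw [Nat.mul_succ, pow_add, mul_apply_eq_comp, h, map_smul, ih, smul_smul, pow_succ']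

/-- Iterating a weighted shift. -/
lemma pow_apply_eq_prod_smul {E : Type*} [NormedAddCommGroup E] [NormedSpace ℂ E]
    (f : E →L[ℂ] E) (u : ℕ → E) (c : ℕ → ℂ) (j : ℕ)
    (h : ∀ i < j, f (u i) = c i • u (i + 1)) :
    (f ^ j) (u 0) = (∏ i ∈ Finset.range j, c i) • u j := by
  induction j with
  | zero => simp
  | succ j ih =>
    rw [pow_succ', mul_apply_eq_comp, ih fun i hi => h i (by omega), map_smul,
      h j (by omega), smul_smul, Finset.prod_range_succ]

/-- The product of the weights over a block of length `d`. -/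
lemma prod_block_weights {d p q : ℕ} (hd : 2 * q + p < d) (c : ℕ → ℂ)
    (hc : ∀ i, i + 1 < d → c i = if i + 1 ≤ p then (1 / 2 : ℂ)
      else if i + 1 < d - 2 * q then 1 else if i + 1 < d - q then (1 / 2 : ℂ) else 2) :
    ∏ i ∈ Finset.range (d - 1), c i = (1 / 2 : ℂ) ^ p := by
  obtain ⟨r, rfl⟩ : ∃ r, d = p + r + q + q + 1 := ⟨d - 1 - 2 * q - p, by omega⟩
  have h₁ : ∏ i ∈ Finset.range p, c i = (1 / 2 : ℂ) ^ p := by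
    rw [Finset.prod_congr rfl (g := fun _ => (1 / 2 : ℂ))]
    · simp
    · intro i hi
      rw [Finset.mem_range] at hi
      rw [hc i (by omega), if_pos (by omega)]
  have h₂ : ∏ i ∈ Finset.range r, c (p + i) = 1 := by
    refine Finset.prod_eq_one fun i hi => ?_
    rw [Finset.mem_range] at hi
    rw [hc _ (by omega), if_neg (by omega), if_pos (by omega)]
  have h₃ : ∏ i ∈ Finset.range q, c (p + r + i) = (1 / 2 : ℂ) ^ q := by
    rw [Finset.prod_congr rfl (g := fun _ => (1 / 2 : ℂ))]
    · simp
    · intro i hi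
      rw [Finset.mem_range] at hi
      rw [hc _ (by omega), if_neg (by omega), if_neg (by omega), if_pos (by omega)]
  have h₄ : ∏ i ∈ Finset.range q, c (p + r + q + i) = (2 : ℂ) ^ q := by
    rw [Finset.prod_congr rfl (g := fun _ => (2 : ℂ))]
    · simp
    · intro i hi
      rw [Finset.mem_range] at hi
      rw [hc _ (by omega), if_neg (by omega), if_neg (by omega), if_neg (by omega)]
  rw [Nat.add_sub_cancel, Finset.prod_range_add, Finset.prod_range_add, Finset.prod_range_add,
    h₁, h₂, h₃, h₄, mul_one, mul_assoc, ← mul_pow]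
  norm_num

/-- If `f ^ a` maps `x` to `c • (y - x)` and acts on `y` as `c`, then `f ^ (2 * a)` acts on `x`
as `c ^ 2`. -/
lemma pow_two_mul_apply_eq_smul {E : Type*} [NormedAddCommGroup E] [NormedSpace ℂ E]
    (f : E →L[ℂ] E) {x y : E} {a : ℕ} {c : ℂ} (hx : (f ^ a) x = c • (y - x))
    (hy : (f ^ a) y = c • y) : (f ^ (2 * a)) x = c ^ 2 • x := by
  rw [two_mul, pow_add, mul_apply_eq_comp, hx, map_smul, map_sub, hx, hy, ← smul_sub,
    smul_smul, sub_sub_cancel, sq]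

lemma two_mul_dvd_of_lt {Δ : ℕ → ℕ} (hdvd : ∀ k, 2 * Δ k ∣ Δ (k + 1)) {l k : ℕ} (h : l < k) :
    2 * Δ l ∣ Δ k := by
  induction k, h using Nat.le_induction with
  | base => exact hdvd l
  | succ k _ ih => exact ih.trans ((Dvd.intro_left 2 rfl).trans (hdvd k))

/-- The dyadic blocks `[2 ^ k / 2, 2 ^ (k + 1) / 2)` cover `ℕ`. -/
lemma exists_dyadic_block (m : ℕ) : ∃ k, 2 ^ k / 2 ≤ m ∧ m < 2 ^ (k + 1) / 2 := by
  rcases Nat.eq_zero_or_pos m with rfl | hm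
  · exact ⟨0, by norm_num⟩
  · refine ⟨Nat.log 2 m + 1, ?_, ?_⟩
    · rw [pow_succ, Nat.mul_div_cancel _ two_pos]
      exact Nat.pow_log_le_self 2 hm.ne'
    · rw [pow_succ, Nat.mul_div_cancel _ two_pos]
      exact Nat.lt_pow_succ_log_self one_lt_two m

/-- Proposition 3.1: for every `n ≥ 0` (with `n ∈ [n_k, n_{k+1})`, so that `η_n = η^{(k)}`) and
every `x ∈ span{e_j : j < b_{n+1}}`, `T̃^{2(b_{n+1}-b_n)} x = 2^{-2η_n} x`. -/
theorem pow_apply_span_eq_smul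
    -- the parameters `(τ_m)`, `(δ^{(k)})`, `(η^{(k)})`, `(Δ^{(k)})`:
    -- increasing sequences of positive integers
    (τ δ η Δ : ℕ → ℕ)
    (hτ : StrictMono τ) (hτpos : ∀ m, 0 < τ m)
    (hδ : StrictMono δ) (hδpos : ∀ k, 0 < δ k)
    (hη : StrictMono η) (hηpos : ∀ k, 0 < η k)
    (hΔ : StrictMono Δ) (hΔpos : ∀ k, 0 < Δ k)
    (hcomb : ∀ k, 2 * δ k + η k < Δ k)
    (hdvd : ∀ k, 2 * Δ k ∣ Δ (k + 1))
    (hratio : ∀ k, (η k : ℝ) / (Δ k : ℝ) = (η 0 : ℝ) / (Δ 0 : ℝ))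
    -- `n_0 = 0` and `n_k = 2^{k-1}` for `k ≥ 1`
    (nseq : ℕ → ℕ) (hn0 : nseq 0 = 0) (hnk : ∀ k, 1 ≤ k → nseq k = 2 ^ (k - 1))
    -- `φ(n) = n - n_k` for `n ∈ [n_k, n_{k+1})`
    (φ : ℕ → ℕ) (hφ : ∀ k n, nseq k ≤ n → n < nseq (k + 1) → φ n = n - nseq k)
    -- `v_n = 2^{-τ_{φ(n)}}` for `n ≥ 1`
    (v : ℕ → ℂ) (hv : ∀ n, 1 ≤ n → v n = (2 : ℂ) ^ (-(τ (φ n) : ℤ)))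
    -- `b_0 = 0` and `b_{n+1} - b_n = Δ^{(k)}` for `n ∈ [n_k, n_{k+1})`
    (b : ℕ → ℕ) (hb0 : b 0 = 0)
    (hb : ∀ k n, nseq k ≤ n → n < nseq (k + 1) → b (n + 1) = b n + Δ k)
    -- the weights `(w_i)`
    (w : ℕ → ℂ)
    (hw : ∀ k n, nseq k ≤ n → n < nseq (k + 1) → ∀ i, b n < i → i < b (n + 1) →
      w i = if i ≤ b n + η k then (1 / 2 : ℂ)
        else if i < b (n + 1) - 2 * δ k then 1
        else if i < b (n + 1) - δ k then (1 / 2 : ℂ)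
        else 2)
    -- the defining equations of the operator `T̃`
    (T : X →L[ℂ] X)
    (hT1 : ∀ n k, b n ≤ k → k + 1 < b (n + 1) → T (e k) = w (k + 1) • e (k + 1))
    (hT2 : ∀ n, 1 ≤ n → T (e (b (n + 1) - 1)) = v n • e (b (φ n)) - e (b n))
    (hT3 : T (e (b 1 - 1)) = -(e 0))
    : ∀ k n, nseq k ≤ n → n < nseq (k + 1) →
      ∀ x ∈ Submodule.span ℂ {y : X | ∃ j, j < b (n + 1) ∧ y = e j},
        (T ^ (2 * (b (n + 1) - b n))) x = ((2 : ℂ) ^ (-(2 * (η k : ℤ)))) • x := by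
  have hN : ∀ k, nseq k = 2 ^ k / 2 := by
    rintro (_ | k)
    · simpa using hn0
    · rw [hnk _ (by omega), pow_succ, Nat.mul_div_cancel _ two_pos, Nat.add_sub_cancel]
  have hNmono : Monotone nseq := fun i j h => by
    rw [hN, hN]
    exact Nat.div_le_div_right (Nat.pow_le_pow_right two_pos h)
  have hblock : ∀ m, ∃ k, nseq k ≤ m ∧ m < nseq (k + 1) := fun m => by
    simpa only [hN] using exists_dyadic_block m
  have hcross : ∀ k l, η k * Δ l = η l * Δ k := fun k l => by
    have hk : (Δ k : ℝ) ≠ 0 := by exact_mod_cast (hΔpos k).ne'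
    have hl : (Δ l : ℝ) ≠ 0 := by exact_mod_cast (hΔpos l).ne'
    have h := (hratio k).trans (hratio l).symm
    rw [div_eq_div_iff hk hl] at h
    exact_mod_cast h
  have hηmul : ∀ {k l a : ℕ}, Δ k = Δ l * a → η k = η l * a := fun {k l a} h => by
    have := hcross k l
    rw [h] at this
    exact Nat.eq_of_mul_eq_mul_right (hΔpos l) (by linarith)
  have hshift : ∀ {k n : ℕ}, nseq k ≤ n → n < nseq (k + 1) → ∀ j, j + 1 ≤ Δ k →
      (T ^ j) (e (b n)) = (∏ i ∈ Finset.range j, w (b n + i + 1)) • e (b n + j) := by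
    intro k n h₁ h₂ j hj
    refine pow_apply_eq_prod_smul T (fun i => e (b n + i)) _ j fun i hi => ?_
    exact hT1 n (b n + i) (by omega) (by rw [hb k n h₁ h₂]; omega)
  have hfull : ∀ {k n : ℕ}, nseq k ≤ n → n < nseq (k + 1) →
      (T ^ Δ k) (e (b n)) = (1 / 2 : ℂ) ^ η k • T (e (b (n + 1) - 1)) := by
    intro k n h₁ h₂
    have hpos := hΔpos k
    have hprod := prod_block_weights (hcomb k) (fun i => w (b n + i + 1)) fun i hi => by
      rw [hw k n h₁ h₂ _ (by omega) (by rw [hb k n h₁ h₂]; omega), hb k n h₁ h₂]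
      have := hcomb k
      congr 1
      · exact propext (by omega)
      congr 1
      · exact propext (by omega)
      congr 1
      exact propext (by omega)
    have hlast : b (n + 1) - 1 = b n + (Δ k - 1) := by
      rw [hb k n h₁ h₂]
      omega
    rw [← Nat.sub_add_cancel (show 1 ≤ Δ k from hpos), pow_succ', mul_apply_eq_comp,
      hshift h₁ h₂ _ (by omega), hprod, map_smul, hlast]
  have hwne : ∀ {k n : ℕ}, nseq k ≤ n → n < nseq (k + 1) → ∀ i, b n < i → i < b (n + 1) →
      w i ≠ 0 := by
    intro k n h₁ h₂ i hi hi'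
    rw [hw k n h₁ h₂ i hi hi']
    split_ifs <;> norm_num
  have hbasis : ∀ n k, nseq k ≤ n → n < nseq (k + 1) → ∀ j < b (n + 1),
      (T ^ (2 * Δ k)) (e j) = ((1 / 2 : ℂ) ^ η k) ^ 2 • e j := by
    intro n
    induction n using Nat.strong_induction_on with
    | _ n ih =>
    intro k h₁ h₂ j hj
    rcases lt_or_ge j (b n) with hjn | hjn
    · obtain ⟨m, rfl⟩ : ∃ m, n = m + 1 :=
        Nat.exists_eq_succ_of_ne_zero (by rintro rfl; omega)
      obtain ⟨l, hl₁, hl₂⟩ := hblock m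
      have hlk : l ≤ k := by
        by_contra! h
        have := hNmono (show k + 1 ≤ l from h)
        omega
      have hdiv : Δ l ∣ Δ k := by
        rcases hlk.eq_or_lt with rfl | hlt
        · rfl
        · exact (Dvd.intro_left 2 rfl).trans (two_mul_dvd_of_lt hdvd hlt)
      obtain ⟨a, ha⟩ := hdiv
      have := pow_mul_apply_eq_smul T (ih m (by omega) l hl₁ hl₂ j hjn) a
      rw [ha, hηmul ha, ← mul_assoc, this, ← pow_mul, ← pow_mul, ← pow_mul]
      congr 2
      ring
    · have hstart : (T ^ (2 * Δ k)) (e (b n)) = ((1 / 2 : ℂ) ^ η k) ^ 2 • e (b n) := by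
        rcases Nat.eq_zero_or_pos n with rfl | hn
        · refine pow_two_mul_apply_eq_smul T (y := 0) ?_ (by simp)
          rw [hfull h₁ h₂, zero_add, hT3, hb0, zero_sub]
        · refine pow_two_mul_apply_eq_smul T (y := v n • e (b (φ n))) ?_ ?_
          · rw [hfull h₁ h₂, hT2 n hn]
          · obtain ⟨p, rfl⟩ : ∃ p, k = p + 1 := by
              refine Nat.exists_eq_succ_of_ne_zero ?_
              rintro rfl
              have := hN 1
              norm_num at this h₂
              omega
            have hφlt : φ n < nseq (p + 1) := by
              rw [hφ _ n h₁ h₂]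
              have h₃ := hN (p + 1)
              have h₄ := hN (p + 1 + 1)
              rw [pow_succ, Nat.mul_div_cancel _ two_pos] at h₃ h₄
              rw [pow_succ] at h₄
              omega
            obtain ⟨l, hl₁, hl₂⟩ := hblock (φ n)
            have hlt : l < p + 1 := by
              by_contra! h
              have := hNmono h
              omega
            obtain ⟨a, ha⟩ := two_mul_dvd_of_lt hdvd hlt
            have hηa : η (p + 1) = η l * (2 * a) := hηmul (by rw [ha]; ring)
            have hφb : b (φ n) < b (φ n + 1) := by
              rw [hb l _ hl₁ hl₂]
              have := hΔpos l
              omega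
            have := pow_mul_apply_eq_smul T (ih (φ n) (by omega) l hl₁ hl₂ _ hφb) a
            rw [map_smul, ha, hηa, this, ← pow_mul, ← pow_mul, smul_comm]
      obtain ⟨i, rfl⟩ := Nat.exists_eq_add_of_le hjn
      rw [hb k n h₁ h₂] at hj
      have hsh := hshift h₁ h₂ i (by omega)
      have hne : ∏ s ∈ Finset.range i, w (b n + s + 1) ≠ 0 := by
        refine Finset.prod_ne_zero_iff.2 fun s hs => hwne h₁ h₂ _ (by omega) ?_
        rw [Finset.mem_range] at hs
        rw [hb k n h₁ h₂]
        omega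
      refine smul_right_injective X hne ?_
      change _ • _ = _ • _
      rw [smul_comm _ (((1 / 2 : ℂ) ^ η k) ^ 2), ← map_smul, ← hsh,
        ← mul_apply_eq_comp, ← pow_add, add_comm, pow_add,
        mul_apply_eq_comp, hstart, map_smul]
  intro k n h₁ h₂ x hx
  have hscalar : (2 : ℂ) ^ (-(2 * (η k : ℤ))) = ((1 / 2 : ℂ) ^ η k) ^ 2 := by
    rw [zpow_neg, ← pow_mul, one_div, inv_pow, mul_comm]
    norm_cast
  rw [hscalar, hb k n h₁ h₂, Nat.add_sub_cancel_left]
  induction hx using Submodule.span_induction with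
  | mem y hy =>
    obtain ⟨j, hj, rfl⟩ := hy
    exact hbasis n k h₁ h₂ j hj
  | zero => simp
  | add y z _ _ hy hz => rw [map_add, hy, hz, smul_add]
  | smul c y _ hy => rw [map_smul, hy, smul_comm]
end
end

section
/- For every K_0 ≥ 0 and every N ≥ 1, there exists K ≥ K_0 such that for every n ∈ [n_K, n_K + N) and every k ≥ 0, ‖T̃^k e_{b_n}‖ ≤ 2^{−(η^{(0)}/(3Δ^{(0)})) k}. -/
open scoped Classical

noncomputable section

theorem norm_e (k : ℕ) : ‖e k‖ = 1 := by
  simp [e, lp.norm_single]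

/-- The exponent `E` such that the first `k` weights of a block of length `D` multiply to
`(1 / 2) ^ E`. -/
def blockExponent (D η δ k : ℕ) : ℕ :=
  if k ≤ η then k
  else if k < D - 2 * δ then η
  else if k < D - δ then η + (k + 1 - (D - 2 * δ))
  else η + (D - 1 - k)

theorem blockExponent_last {D η δ : ℕ} (hδ : 0 < δ) (hcomb : 2 * δ + η < D) :
    blockExponent D η δ (D - 1) = η := by
  unfold blockExponent
  split_ifs <;> omega

theorem half_pow_blockExponent_mul_weight (s : ℕ) {D η δ k : ℕ} (hcomb : 2 * δ + η < D)
    (hk : k + 1 < D) :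
    (1 / 2 : ℂ) ^ blockExponent D η δ k *
        (if s + k + 1 ≤ s + η then (1 / 2 : ℂ)
          else if s + k + 1 < s + D - 2 * δ then 1
          else if s + k + 1 < s + D - δ then (1 / 2 : ℂ)
          else 2) =
      (1 / 2) ^ blockExponent D η δ (k + 1) := by
  have half : ∀ {m l : ℕ}, l = m + 1 → (1 / 2 : ℂ) ^ m * (1 / 2) = (1 / 2) ^ l := by
    rintro m l rfl
    rw [pow_succ]
  have double : ∀ {m l : ℕ}, m = l + 1 → (1 / 2 : ℂ) ^ m * 2 = (1 / 2) ^ l := by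
    rintro m l rfl
    rw [pow_succ, mul_assoc]
    norm_num
  by_cases h₁ : k + 1 ≤ η
  · rw [if_pos (by omega)]
    apply half
    unfold blockExponent
    split_ifs <;> omega
  rw [if_neg (by omega)]
  by_cases h₂ : k + 1 < D - 2 * δ
  · rw [if_pos (by omega), mul_one]
    congr 1
    unfold blockExponent
    split_ifs <;> omega
  rw [if_neg (by omega)]
  by_cases h₃ : k + 1 < D - δ
  · rw [if_pos (by omega)]
    apply half
    unfold blockExponent
    split_ifs <;> omega
  · rw [if_neg (by omega)]
    apply double
    unfold blockExponent
    split_ifs <;> omega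

/-- The orbit of the first basis vector of a block, as long as it stays in the block. -/
theorem pow_apply_block_start (T : X →L[ℂ] X) (w : ℕ → ℂ) {s D η δ : ℕ}
    (hcomb : 2 * δ + η < D)
    (hw : ∀ i, s < i → i < s + D →
      w i = if i ≤ s + η then (1 / 2 : ℂ)
        else if i < s + D - 2 * δ then 1
        else if i < s + D - δ then (1 / 2 : ℂ)
        else 2)
    (hT : ∀ k, s ≤ k → k + 1 < s + D → T (e k) = w (k + 1) • e (k + 1)) (k : ℕ) (hk : k < D) :
    (T ^ k) (e s) = ((1 / 2 : ℂ) ^ blockExponent D η δ k) • e (s + k) := by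
  induction k with
  | zero => simp [blockExponent]
  | succ k ih =>
    rw [pow_succ', mul_apply_eq_comp, ih (by omega), map_smul,
      hT (s + k) (by omega) (by omega), smul_smul, ← add_assoc,
      hw (s + k + 1) (by omega) (by omega)]
    congr 1
    exact half_pow_blockExponent_mul_weight s hcomb hk

theorem half_pow_blockExponent_le {D η δ : ℕ} {β : ℝ} (hβ : 1 / 2 ≤ β) (hβ1 : β ≤ 1)
    (hβη : β ^ (3 * D) = (1 / 2) ^ η) {k : ℕ} (hk : k < D) :
    (1 / 2 : ℝ) ^ blockExponent D η δ k ≤ β ^ k := by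
  by_cases h : k ≤ η
  · rw [blockExponent, if_pos h]
    exact pow_le_pow_left₀ (by norm_num) hβ k
  · calc (1 / 2 : ℝ) ^ blockExponent D η δ k ≤ (1 / 2) ^ η :=
          pow_le_pow_of_le_one (by norm_num) (by norm_num) (by grind [blockExponent])
      _ = β ^ (3 * D) := hβη.symm
      _ ≤ β ^ k := pow_le_pow_of_le_one (by linarith) hβ1 (by omega)

/-- Geometric decay is inherited through a relation `T ^ D x = r • (u • y - x)` with `r` small. -/
theorem norm_pow_apply_le_of_return {E : Type*} [NormedAddCommGroup E] [NormedSpace ℂ E]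
    (T : E →L[ℂ] E) {x y : E} {r u : ℂ} {D : ℕ} {β M M' : ℝ} (hD : 0 < D) (hβ : 0 ≤ β)
    (hu : ‖u‖ ≤ 1) (hr : ‖r‖ = β ^ (3 * D))
    (hret : (T ^ D) x = r • (u • y - x))
    (hx : ∀ k < D, ‖(T ^ k) x‖ ≤ M' * β ^ k) (hy : ∀ k, ‖(T ^ k) y‖ ≤ M * β ^ k)
    (hsmall : β ^ (2 * D) * (M + M') ≤ M') (k : ℕ) :
    ‖(T ^ k) x‖ ≤ M' * β ^ k := by
  induction k using Nat.strong_induction_on with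
  | _ k ih =>
    by_cases hk : k < D
    · exact hx k hk
    obtain ⟨j, rfl⟩ : ∃ j, k = j + D := ⟨k - D, by omega⟩
    rw [pow_add, mul_apply_eq_comp, hret, map_smul, map_sub, map_smul, norm_smul, hr]
    have hj := ih j (by omega)
    have h₁ : ‖u • (T ^ j) y - (T ^ j) x‖ ≤ (M + M') * β ^ j := by
      calc ‖u • (T ^ j) y - (T ^ j) x‖ ≤ ‖u • (T ^ j) y‖ + ‖(T ^ j) x‖ := norm_sub_le _ _
        _ ≤ 1 * (M * β ^ j) + M' * β ^ j := by
            rw [norm_smul]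
            gcongr
            exact hy j
        _ = (M + M') * β ^ j := by ring
    calc β ^ (3 * D) * ‖u • (T ^ j) y - (T ^ j) x‖
        ≤ β ^ (3 * D) * ((M + M') * β ^ j) := by gcongr
      _ = (β ^ (2 * D) * (M + M')) * β ^ (j + D) := by ring
      _ ≤ M' * β ^ (j + D) := by gcongr

/-- Lemma 3.2 (2): for every `K₀ ≥ 0` and `N ≥ 1` there exists `K ≥ K₀` such that for every
`n ∈ [n_K, n_K + N)` and every `k ≥ 0`, `‖T̃^k e_{b_n}‖ ≤ 2^{-(η⁽⁰⁾/(3Δ⁽⁰⁾)) k}`. -/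
theorem decay_of_basis_block
    -- the parameters `(τ_m)`, `(δ^{(k)})`, `(η^{(k)})`, `(Δ^{(k)})`:
    -- increasing sequences of positive integers
    (τ δ η Δ : ℕ → ℕ)
    (hτ : StrictMono τ) (hτpos : ∀ m, 0 < τ m)
    (hδ : StrictMono δ) (hδpos : ∀ k, 0 < δ k)
    (hη : StrictMono η) (hηpos : ∀ k, 0 < η k)
    (hΔ : StrictMono Δ) (hΔpos : ∀ k, 0 < Δ k)
    (hcomb : ∀ k, 2 * δ k + η k < Δ k)
    (hdvd : ∀ k, 2 * Δ k ∣ Δ (k + 1))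
    (hratio : ∀ k, (η k : ℝ) / (Δ k : ℝ) = (η 0 : ℝ) / (Δ 0 : ℝ))
    -- `n_0 = 0` and `n_k = 2^{k-1}` for `k ≥ 1`
    (nseq : ℕ → ℕ) (hn0 : nseq 0 = 0) (hnk : ∀ k, 1 ≤ k → nseq k = 2 ^ (k - 1))
    -- `φ(n) = n - n_k` for `n ∈ [n_k, n_{k+1})`
    (φ : ℕ → ℕ) (hφ : ∀ k n, nseq k ≤ n → n < nseq (k + 1) → φ n = n - nseq k)
    -- `v_n = 2^{-τ_{φ(n)}}` for `n ≥ 1`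
    (v : ℕ → ℂ) (hv : ∀ n, 1 ≤ n → v n = (2 : ℂ) ^ (-(τ (φ n) : ℤ)))
    -- `b_0 = 0` and `b_{n+1} - b_n = Δ^{(k)}` for `n ∈ [n_k, n_{k+1})`
    (b : ℕ → ℕ) (hb0 : b 0 = 0)
    (hb : ∀ k n, nseq k ≤ n → n < nseq (k + 1) → b (n + 1) = b n + Δ k)
    -- the weights `(w_i)`
    (w : ℕ → ℂ)
    (hw : ∀ k n, nseq k ≤ n → n < nseq (k + 1) → ∀ i, b n < i → i < b (n + 1) →
      w i = if i ≤ b n + η k then (1 / 2 : ℂ)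
        else if i < b (n + 1) - 2 * δ k then 1
        else if i < b (n + 1) - δ k then (1 / 2 : ℂ)
        else 2)
    -- the defining equations of the operator `T̃`
    (T : X →L[ℂ] X)
    (hT1 : ∀ n k, b n ≤ k → k + 1 < b (n + 1) → T (e k) = w (k + 1) • e (k + 1))
    (hT2 : ∀ n, 1 ≤ n → T (e (b (n + 1) - 1)) = v n • e (b (φ n)) - e (b n))
    (hT3 : T (e (b 1 - 1)) = -(e 0))
    : ∀ K₀ : ℕ, ∀ N : ℕ, 1 ≤ N →
      ∃ K, K₀ ≤ K ∧ ∀ n, nseq K ≤ n → n < nseq K + N → ∀ k : ℕ,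
        ‖(T ^ k) (e (b n))‖ ≤ (2 : ℝ) ^ (-((η 0 : ℝ) / (3 * (Δ 0 : ℝ))) * (k : ℝ)) := by
  set a : ℝ := (η 0 : ℝ) / (3 * (Δ 0 : ℝ)) with ha
  set β : ℝ := (2 : ℝ) ^ (-a) with hβdef
  have hβpos : 0 < β := by positivity
  have hΔ0 : (0 : ℝ) < Δ 0 := by exact_mod_cast hΔpos 0
  have hη0 : (0 : ℝ) < η 0 := by exact_mod_cast hηpos 0
  have ha0 : 0 < a := by positivity
  have ha1 : a ≤ 1 := by
    have : (η 0 : ℝ) ≤ Δ 0 := by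
      have := hcomb 0
      exact_mod_cast (by omega : η 0 ≤ Δ 0)
    rw [ha, div_le_one (by positivity)]
    linarith
  have hβ1 : β < 1 := Real.rpow_lt_one_of_one_lt_of_neg (by norm_num) (by linarith)
  have hβhalf : 1 / 2 ≤ β := by
    calc (1 / 2 : ℝ) = (2 : ℝ) ^ (-1 : ℝ) := by rw [Real.rpow_neg_one]; norm_num
      _ ≤ β := Real.rpow_le_rpow_of_exponent_le (by norm_num) (by linarith)
  have hβη : ∀ k, β ^ (3 * Δ k) = (1 / 2 : ℝ) ^ η k := by
    intro k
    have hΔk : (Δ k : ℝ) ≠ 0 := by exact_mod_cast (hΔpos k).ne'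
    have h := hratio k
    have hexp : -a * ((3 * Δ k : ℕ) : ℝ) = -(η k : ℝ) := by
      have hηk : (η k : ℝ) = η 0 / Δ 0 * Δ k := by rw [← h]; field_simp
      rw [hηk, ha]
      push_cast
      field_simp
    rw [hβdef, ← Real.rpow_natCast, ← Real.rpow_mul (by norm_num), hexp,
      Real.rpow_neg (by norm_num), Real.rpow_natCast, one_div, inv_pow]
  have hβpow : ∀ k : ℕ, (2 : ℝ) ^ (-a * (k : ℝ)) = β ^ k := by
    intro k
    rw [Real.rpow_mul (by norm_num), Real.rpow_natCast]
  have hinit : ∀ k n, nseq k ≤ n → n < nseq (k + 1) → ∀ j < Δ k,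
      (T ^ j) (e (b n)) =
        ((1 / 2 : ℂ) ^ blockExponent (Δ k) (η k) (δ k) j) • e (b n + j) := by
    intro k n h₁ h₂
    have hbn := hb k n h₁ h₂
    refine pow_apply_block_start T w (hcomb k) ?_ ?_
    · simpa only [hbn] using hw k n h₁ h₂
    · simpa only [hbn] using hT1 n
  have hinit_norm : ∀ k n, nseq k ≤ n → n < nseq (k + 1) → ∀ j < Δ k,
      ‖(T ^ j) (e (b n))‖ ≤ β ^ j := by
    intro k n h₁ h₂ j hj
    rw [hinit k n h₁ h₂ j hj, norm_smul, norm_e, mul_one, norm_pow]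
    simpa using half_pow_blockExponent_le (δ := δ k) hβhalf hβ1.le (hβη k) hj
  have hturn : ∀ k n, nseq k ≤ n → n < nseq (k + 1) →
      (T ^ Δ k) (e (b n)) = ((1 / 2 : ℂ) ^ η k) • T (e (b (n + 1) - 1)) := by
    intro k n h₁ h₂
    have hD := hΔpos k
    obtain ⟨D, hDk⟩ : ∃ D, Δ k = D + 1 := ⟨Δ k - 1, by omega⟩
    have hi := hinit k n h₁ h₂ (Δ k - 1) (by omega)
    rw [blockExponent_last (hδpos k) (hcomb k)] at hi
    rw [hb k n h₁ h₂, Nat.add_sub_assoc hD, ← map_smul, ← hi, hDk, Nat.add_sub_cancel, pow_succ',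
      mul_apply_eq_comp]
  have hr : ∀ k, ‖(1 / 2 : ℂ) ^ η k‖ = β ^ (3 * Δ k) := by
    intro k
    rw [hβη, norm_pow]
    simp
  have hvnorm : ∀ n, 1 ≤ n → ‖v n‖ ≤ 1 := by
    intro n hn
    rw [hv n hn, zpow_neg, zpow_natCast, norm_inv, norm_pow, Complex.norm_ofNat]
    exact inv_le_one_of_one_le₀ (one_le_pow₀ (by norm_num))
  have hlevel : ∀ n, 1 ≤ n → ∃ k, 1 ≤ k ∧ nseq k ≤ n ∧ n < nseq (k + 1) := by
    intro n hn
    refine ⟨Nat.log 2 n + 1, by omega, ?_, ?_⟩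
    · rw [hnk _ (by omega), Nat.add_sub_cancel]
      exact Nat.pow_log_le_self 2 (by omega)
    · rw [hnk _ (by omega), Nat.add_sub_cancel]
      exact Nat.lt_pow_succ_log_self (by norm_num) n
  have hdecay : ∀ m, ∃ M : ℝ, 0 ≤ M ∧ ∀ k, ‖(T ^ k) (e (b m))‖ ≤ M * β ^ k := by
    have hnext : ∀ k n, nseq k ≤ n → n < nseq (k + 1) → ∀ (y : X) (u : ℂ) (M : ℝ), 0 ≤ M →
        ‖u‖ ≤ 1 → (∀ j, ‖(T ^ j) y‖ ≤ M * β ^ j) → T (e (b (n + 1) - 1)) = u • y - e (b n) →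
        ∃ M' : ℝ, 0 ≤ M' ∧ ∀ j, ‖(T ^ j) (e (b n))‖ ≤ M' * β ^ j := by
      intro k n h₁ h₂ y u M hM hu hy hTe
      have hq : β ^ (2 * Δ k) < 1 := pow_lt_one₀ hβpos.le hβ1 (by have := hΔpos k; omega)
      set q := β ^ (2 * Δ k) with hqdef
      have hq0 : 0 ≤ q := by positivity
      have hq' : 0 < 1 - q := by linarith
      refine ⟨1 + q * M / (1 - q), by positivity, ?_⟩
      refine norm_pow_apply_le_of_return T (hΔpos k) hβpos.le hu (hr k)
        (by rw [hturn k n h₁ h₂, hTe]) ?_ hy ?_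
      · intro j hj
        refine (hinit_norm k n h₁ h₂ j hj).trans (le_mul_of_one_le_left (by positivity) ?_)
        have : 0 ≤ q * M / (1 - q) := by positivity
        linarith
      · have : q * M / (1 - q) * (1 - q) = q * M := div_mul_cancel₀ _ hq'.ne'
        rw [← hqdef]
        linarith
    intro m
    induction m using Nat.strong_induction_on with
    | _ m ih =>
      rcases Nat.eq_zero_or_pos m with rfl | hm
      · refine hnext 0 0 hn0.le (by simp [hnk]) 0 0 0 le_rfl (by simp) (by simp) ?_
        simp [hT3, hb0]
      · obtain ⟨k, hk, h₁, h₂⟩ := hlevel m hm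
        have hpos : 0 < nseq k := by rw [hnk k hk]; positivity
        obtain ⟨M, hM, hy⟩ := ih (φ m) (by rw [hφ k m h₁ h₂]; omega)
        exact hnext k m h₁ h₂ _ _ M hM (hvnorm m hm) hy (hT2 m hm)
  intro K₀ N _
  choose M hM0 hM using hdecay
  obtain ⟨C, hC⟩ : ∃ C, ∀ m < N, M m ≤ C :=
    ⟨∑ i ∈ Finset.range N, M i, fun m hm =>
      Finset.single_le_sum (fun i _ => hM0 i) (Finset.mem_range.2 hm)⟩
  have hlim : Filter.Tendsto (fun K => β ^ (2 * Δ K) * (C + 1)) Filter.atTop (nhds 0) := by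
    have h := ((tendsto_pow_atTop_nhds_zero_of_lt_one hβpos.le hβ1).comp
      ((hΔ.const_mul (by norm_num : 0 < 2)).tendsto_atTop)).mul_const (C + 1)
    simpa using h
  obtain ⟨K, hK, hKlarge⟩ := ((hlim.eventually_le_const one_pos).and
    (Filter.eventually_ge_atTop (K₀ + N + 1))).exists
  refine ⟨K, by omega, fun n h₁ h₂ k => ?_⟩
  have hn : n < nseq (K + 1) := by
    have hN : N < 2 ^ (K - 1) := Nat.lt_two_pow_self.trans_le' (by omega)
    rw [hnk K (by omega)] at h₂
    rw [hnk (K + 1) (by omega), Nat.add_sub_cancel, show K = K - 1 + 1 by omega, pow_succ]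
    omega
  have hn1 : 1 ≤ n := by
    have : 0 < nseq K := by rw [hnk K (by omega)]; positivity
    omega
  have hφn : φ n < N := by rw [hφ K n h₁ hn]; omega
  rw [hβpow, ← one_mul (β ^ k)]
  refine norm_pow_apply_le_of_return T (hΔpos K) hβpos.le (hvnorm n hn1) (hr K)
    (by rw [hturn K n h₁ hn, hT2 n hn1]) ?_ (hM (φ n)) ?_ k
  · simpa only [one_mul] using hinit_norm K n h₁ hn
  · refine le_trans ?_ hK
    gcongr
    exact hC _ hφn
end
end

section
/- For every x ∈ X, ‖T̃⁻¹ x‖ ≤ 2‖x‖. -/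
open scoped Classical

noncomputable section

/-- On `ℓ¹(ℕ)`, a bound on the images of the canonical basis bounds the whole operator. -/
theorem norm_apply_le_of_basis (S : X →L[ℂ] X) (C : ℝ) (hC : ∀ i, ‖S (e i)‖ ≤ C) (x : X) :
    ‖S x‖ ≤ C * ‖x‖ := by
  have hx : HasSum (fun i => ‖x i‖) ‖x‖ := by
    simpa using lp.hasSum_norm (p := 1) (by simp) x
  have hsingle (i : ℕ) : lp.single 1 i (x i) = x i • e i := by
    rw [e, ← lp.single_smul, smul_eq_mul, mul_one]
  have hSx : HasSum (fun i => x i • S (e i)) (S x) := by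
    simpa only [hsingle, map_smul] using S.hasSum (lp.hasSum_single ENNReal.one_ne_top x)
  have hle (i : ℕ) : ‖x i • S (e i)‖ ≤ C * ‖x i‖ := by
    rw [norm_smul, mul_comm]
    exact mul_le_mul_of_nonneg_right (hC i) (norm_nonneg _)
  exact hSx.norm_le_of_bounded (hx.mul_left C) hle

/-- A strictly increasing sequence starting at `0` cuts `ℕ` into consecutive blocks. -/
theorem exists_block {b : ℕ → ℕ} (hb0 : b 0 = 0) (hb : StrictMono b) (i : ℕ) :
    ∃ n, b n ≤ i ∧ i < b (n + 1) := by
  induction i with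
  | zero => exact ⟨0, hb0.le, by simpa [hb0] using hb Nat.zero_lt_one⟩
  | succ i ih =>
    obtain ⟨n, h₁, h₂⟩ := ih
    by_cases h : i + 1 < b (n + 1)
    · exact ⟨n, by omega, h⟩
    · have := hb (Nat.lt_succ_self (n + 1))
      exact ⟨n + 1, by omega, by simp only [Nat.succ_eq_add_one] at this; omega⟩

/-- Lemma 3.4 (1): `‖T̃⁻¹ x‖ ≤ 2‖x‖` for every `x ∈ ℓ¹(ℕ)`. -/
theorem norm_inv_apply_le
    -- the parameters `(τ_m)`, `(δ^{(k)})`, `(η^{(k)})`, `(Δ^{(k)})`: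
    -- increasing sequences of positive integers
    (τ δ η Δ : ℕ → ℕ)
    (hτ : StrictMono τ) (hτpos : ∀ m, 0 < τ m)
    (hδ : StrictMono δ) (hδpos : ∀ k, 0 < δ k)
    (hη : StrictMono η) (hηpos : ∀ k, 0 < η k)
    (hΔ : StrictMono Δ) (hΔpos : ∀ k, 0 < Δ k)
    (hcomb : ∀ k, 2 * δ k + η k < Δ k)
    (hdvd : ∀ k, 2 * Δ k ∣ Δ (k + 1))
    (hratio : ∀ k, (η k : ℝ) / (Δ k : ℝ) = (η 0 : ℝ) / (Δ 0 : ℝ))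
    -- `n_0 = 0` and `n_k = 2^{k-1}` for `k ≥ 1`
    (nseq : ℕ → ℕ) (hn0 : nseq 0 = 0) (hnk : ∀ k, 1 ≤ k → nseq k = 2 ^ (k - 1))
    -- `φ(n) = n - n_k` for `n ∈ [n_k, n_{k+1})`
    (φ : ℕ → ℕ) (hφ : ∀ k n, nseq k ≤ n → n < nseq (k + 1) → φ n = n - nseq k)
    -- `v_n = 2^{-τ_{φ(n)}}` for `n ≥ 1`
    (v : ℕ → ℂ) (hv : ∀ n, 1 ≤ n → v n = (2 : ℂ) ^ (-(τ (φ n) : ℤ)))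
    -- `b_0 = 0` and `b_{n+1} - b_n = Δ^{(k)}` for `n ∈ [n_k, n_{k+1})`
    (b : ℕ → ℕ) (hb0 : b 0 = 0)
    (hb : ∀ k n, nseq k ≤ n → n < nseq (k + 1) → b (n + 1) = b n + Δ k)
    -- the weights `(w_i)`
    (w : ℕ → ℂ)
    (hw : ∀ k n, nseq k ≤ n → n < nseq (k + 1) → ∀ i, b n < i → i < b (n + 1) →
      w i = if i ≤ b n + η k then (1 / 2 : ℂ)
        else if i < b (n + 1) - 2 * δ k then 1
        else if i < b (n + 1) - δ k then (1 / 2 : ℂ)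
        else 2)
    -- the defining equations of the operator `T̃`
    (T : X →L[ℂ] X)
    (hT1 : ∀ n k, b n ≤ k → k + 1 < b (n + 1) → T (e k) = w (k + 1) • e (k + 1))
    (hT2 : ∀ n, 1 ≤ n → T (e (b (n + 1) - 1)) = v n • e (b (φ n)) - e (b n))
    (hT3 : T (e (b 1 - 1)) = -(e 0))
    -- `T̃` is bijective with continuous inverse `S`
    (S : X →L[ℂ] X) (hS₁ : ∀ x, S (T x) = x) (hS₂ : ∀ x, T (S x) = x) :
    ∀ x : X, ‖S x‖ ≤ 2 * ‖x‖ := by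
  have hnmono : StrictMono nseq := by
    refine strictMono_nat_of_lt_succ fun k => ?_
    rw [hnk (k + 1) (by omega)]
    rcases Nat.eq_zero_or_pos k with rfl | hk
    · simp [hn0]
    · rw [hnk k hk]
      exact Nat.pow_lt_pow_right (by norm_num) (by omega)
  have hlevel := exists_block hn0 hnmono
  have hbmono : StrictMono b := by
    refine strictMono_nat_of_lt_succ fun n => ?_
    obtain ⟨k, h₁, h₂⟩ := hlevel n
    rw [hb k n h₁ h₂]
    exact Nat.lt_add_of_pos_right (hΔpos k)
  have hφlt (n : ℕ) (hn : 1 ≤ n) : φ n < n := by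
    obtain ⟨k, h₁, h₂⟩ := hlevel n
    have hk : k ≠ 0 := by
      rintro rfl
      have : nseq 1 = 1 := by simpa using hnk 1 le_rfl
      rw [zero_add] at h₂
      omega
    have : nseq 0 < nseq k := hnmono (Nat.pos_of_ne_zero hk)
    rw [hφ k n h₁ h₂]
    omega
  have hvnorm (n : ℕ) (hn : 1 ≤ n) : ‖v n‖ ≤ 1 / 2 := by
    rw [hv n hn, zpow_neg, zpow_natCast, norm_inv, norm_pow, Complex.norm_ofNat, one_div]
    exact inv_anti₀ (by norm_num) (le_self_pow₀ (by norm_num) (hτpos _).ne')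
  have hstart (n : ℕ) : ‖S (e (b n))‖ ≤ 2 := by
    induction n using Nat.strong_induction_on with
    | _ n ih =>
      rcases Nat.eq_zero_or_pos n with rfl | hn
      · have h : S (e (b 0)) = -e (b 1 - 1) := by
          rw [hb0, ← hS₁ (e (b 1 - 1)), hT3, map_neg, neg_neg]
        rw [h, norm_neg, norm_e]
        norm_num
      · have h : S (e (b n)) = v n • S (e (b (φ n))) - e (b (n + 1) - 1) := by
          rw [← hS₁ (e (b (n + 1) - 1)), hT2 n hn, map_sub, map_smul, sub_sub_cancel]
        calc ‖S (e (b n))‖ ≤ ‖v n‖ * ‖S (e (b (φ n)))‖ + ‖e (b (n + 1) - 1)‖ := by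
              rw [h, ← norm_smul]
              exact norm_sub_le _ _
          _ ≤ 1 / 2 * 2 + 1 := by
              rw [norm_e]
              gcongr
              exacts [hvnorm n hn, ih _ (hφlt n hn)]
          _ = 2 := by norm_num
  refine norm_apply_le_of_basis S 2 fun i => ?_
  obtain ⟨n, h₁, h₂⟩ := exists_block hb0 hbmono i
  rcases h₁.eq_or_lt with rfl | hlt
  · exact hstart n
  obtain ⟨k, hk₁, hk₂⟩ := hlevel n
  obtain ⟨j, rfl⟩ : ∃ j, i = j + 1 := ⟨i - 1, by omega⟩
  have hwi : 1 / 2 ≤ ‖w (j + 1)‖ := by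
    rw [hw k n hk₁ hk₂ _ hlt h₂]
    split_ifs <;> norm_num
  have h : w (j + 1) • S (e (j + 1)) = e j := by
    rw [← map_smul, ← hT1 n j (by omega) h₂, hS₁]
  have hnorm := congrArg norm h
  rw [norm_smul, norm_e] at hnorm
  nlinarith [norm_nonneg (S (e (j + 1)))]
end
end
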